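/- arXiv:math/0002186 — 3 statements merged into one kernel-verified Lean document; each statement's English description precedes it below -/
import Mathlib

section
/- Let V_0 and V_1 be finite-dimensional complex vector spaces with fixed linear coordinates x_0 and x_1, and let P(x_0, x_1, λ) be an element of the ring R(V_0 × V_1 × ℂ, V_0) with P(x_0, 0, 0) ≡ 0. Fix an integer m ≥ 0 and consider the Laurent series expansion P(x_0, x_1/λ^m, λ) = Σ_{ν∈ℤ} c_ν(x_0, x_1) λ^ν. Then c_0(x_0, 0) ≡ 0 and, for every ν ∈ ℤ, c_ν belongs to the ring R(V_0 × V_1, V_0). Moreover, if P vanishes to order K at the origin for some integer K > 0, then for every ν ∈ ℤ with ν ≤ K, c_ν = O((K − ν)/(m + 1)), i.e. all monomials x_0^α x_1^β appearing in c_ν satisfy |α| + |β| ≥ (K − ν)/(m + 1). -/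
open scoped BigOperators

noncomputable section

/-- Iterated directional (complex) derivative along a list of directions. -/
def iterDeriv {E F : Type*} [NormedAddCommGroup E] [NormedSpace ℂ E]
    [NormedAddCommGroup F] [NormedSpace ℂ F] : List E → (E → F) → E → F
  | [], f => f
  | v :: vs, f => iterDeriv vs fun x => fderiv ℂ f x v

/-- Polynomial functions on a complex vector space. -/
inductive IsPolyFun {V : Type*} [AddCommGroup V] [Module ℂ V] : (V → ℂ) → Prop
  | const (c : ℂ) : IsPolyFun fun _ => c
  | linear (φ : V →ₗ[ℂ] ℂ) : IsPolyFun fun x => φ x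
  | add {f g : V → ℂ} : IsPolyFun f → IsPolyFun g → IsPolyFun fun x => f x + g x
  | mul {f g : V → ℂ} : IsPolyFun f → IsPolyFun g → IsPolyFun fun x => f x * g x

/-- The ring `R(V₀ × V₁, V₀)` of germs along `V₀ × {0}` of holomorphic functions all of
whose partial derivatives restrict to polynomial functions on `V₀ × {0}`. -/
def MemRing (V0 V1 : Type*) [NormedAddCommGroup V0] [NormedSpace ℂ V0]
    [NormedAddCommGroup V1] [NormedSpace ℂ V1] (f : V0 × V1 → ℂ) : Prop :=
  (∃ Ω : Set (V0 × V1), IsOpen Ω ∧ (∀ x0 : V0, ((x0, 0) : V0 × V1) ∈ Ω) ∧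
    AnalyticOnNhd ℂ f Ω) ∧
  ∀ vs : List (V0 × V1), IsPolyFun fun x0 : V0 => iterDeriv vs f ((x0, 0) : V0 × V1)

/-- The basis direction in the `x₁`-slot of `V₀ × (V₁ × ℂ)`. -/
def x1dirP (a b : ℕ) (j : Fin b) : (Fin a → ℂ) × ((Fin b → ℂ) × ℂ) :=
  (0, (Pi.single j 1, 0))

/-- The direction in the `λ`-slot of `V₀ × (V₁ × ℂ)`. -/
def lamdirP (a b : ℕ) : (Fin a → ℂ) × ((Fin b → ℂ) × ℂ) := (0, (0, 1))

/-- The basis direction in the `x₁`-slot of `V₀ × V₁`. -/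
def x1dirC (a b : ℕ) (j : Fin b) : (Fin a → ℂ) × (Fin b → ℂ) := (0, Pi.single j 1)

/-- The list of directions corresponding to the multi-index `β` (in the `x₁`-slot) and
`μ` copies of the `λ`-direction. -/
def dirsP (a b : ℕ) (β : Fin b → ℕ) (μ : ℕ) :
    List ((Fin a → ℂ) × ((Fin b → ℂ) × ℂ)) :=
  ((List.finRange b).flatMap fun j => List.replicate (β j) (x1dirP a b j)) ++
    List.replicate μ (lamdirP a b)

/-- The list of directions corresponding to the multi-index `β` in the `x₁`-slot. -/
def dirsC (a b : ℕ) (β : Fin b → ℕ) : List ((Fin a → ℂ) × (Fin b → ℂ)) :=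
  (List.finRange b).flatMap fun j => List.replicate (β j) (x1dirC a b j)

section Nemytskii

variable {K E F : Type*} [TopologicalSpace K] [CompactSpace K]
  [NormedAddCommGroup E] [NormedSpace ℂ E] [NormedAddCommGroup F] [NormedSpace ℂ F]

/-- The power series acting pointwise on continuous functions on a compact space. -/
def pointwiseSeries (K : Type*) [TopologicalSpace K] [CompactSpace K]
    (p : FormalMultilinearSeries ℂ E F) : FormalMultilinearSeries ℂ C(K, E) C(K, F) := fun n =>
  MultilinearMap.mkContinuous
    { toFun := fun f => ⟨fun t => p n fun i => f i t, by fun_prop⟩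
      map_update_add' := by
        intro _ f i u v
        ext t
        have h : ∀ w : C(K, E), (fun j => (Function.update f i w) j t) =
            Function.update (fun j => f j t) i (w t) := by
          intro w
          ext j
          by_cases hj : j = i
          · subst hj; simp
          · simp [hj]
        simp [h]
      map_update_smul' := by
        intro _ f i c u
        ext t
        have h : ∀ w : C(K, E), (fun j => (Function.update f i w) j t) =
            Function.update (fun j => f j t) i (w t) := by
          intro w
          ext j
          by_cases hj : j = i
          · subst hj; simp
          · simp [hj]
        simp [h] }
    ‖p n‖ (by
      intro f
      refine (ContinuousMap.norm_le _ (by positivity)).2 fun t => ?_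
      refine ((p n).le_opNorm _).trans ?_
      gcongr with i
      exact (f i).norm_coe_le_norm t)

theorem radius_le_radius_pointwiseSeries (p : FormalMultilinearSeries ℂ E F) :
    p.radius ≤ (pointwiseSeries K p).radius := by
  refine ENNReal.le_of_forall_nnreal_lt fun r hr => ?_
  obtain ⟨C, -, hC⟩ := p.norm_mul_pow_le_of_lt_radius hr
  refine (pointwiseSeries K p).le_radius_of_bound C fun n => le_trans ?_ (hC n)
  gcongr
  exact MultilinearMap.mkContinuous_norm_le _ (norm_nonneg _) _

/-- Composition with an analytic function is an analytic operation on continuous functions. -/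
theorem HasFPowerSeriesOnBall.exists_pointwise [CompleteSpace F] {f : E → F}
    {p : FormalMultilinearSeries ℂ E F} {x : E} {R : ℝ}
    (hf : HasFPowerSeriesOnBall f p x (ENNReal.ofReal R)) :
    ∃ G : C(K, E) → C(K, F), AnalyticOnNhd ℂ G (Metric.ball (ContinuousMap.const K x) R) ∧
      ∀ g ∈ Metric.ball (ContinuousMap.const K x) R, ∀ t, G g t = f (g t) := by
  have hR := hf.r_le.trans (radius_le_radius_pointwiseSeries (K := K) p)
  refine ⟨fun g => (pointwiseSeries K p).sum (g - ContinuousMap.const K x), ?_, ?_⟩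
  · have h := ((pointwiseSeries K p).hasFPowerSeriesOnBall (hf.r_pos.trans_le hR)).mono
      hf.r_pos hR
    have h2 := (h.comp_sub (ContinuousMap.const K x)).analyticOnNhd
    rwa [zero_add, Metric.eball_ofReal] at h2
  · intro g hg t
    have hg0 : g - ContinuousMap.const K x ∈ Metric.eball (0 : C(K, E)) (ENNReal.ofReal R) := by
      rw [Metric.eball_ofReal, mem_ball_zero_iff]
      simpa [dist_eq_norm] using hg
    have hs := ((pointwiseSeries K p).summable (Metric.eball_subset_eball hR hg0)).hasSum
    have hs' := hs.mapL (ContinuousMap.evalCLM ℂ t)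
    have ht : g t - x ∈ Metric.eball (0 : E) (ENNReal.ofReal R) := by
      rw [Metric.eball_ofReal, mem_ball_zero_iff] at *
      exact lt_of_le_of_lt ((g - ContinuousMap.const K x).norm_coe_le_norm t) hg0
    have h3 := hf.hasSum ht
    rw [add_sub_cancel] at h3
    exact hs'.unique h3

end Nemytskii

section IterDeriv

variable {E F : Type*} [NormedAddCommGroup E] [NormedSpace ℂ E]
    [NormedAddCommGroup F] [NormedSpace ℂ F]

theorem iterDeriv_append (l₁ l₂ : List E) (f : E → F) :
    iterDeriv (l₁ ++ l₂) f = iterDeriv l₂ (iterDeriv l₁ f) := by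
  induction l₁ generalizing f with
  | nil => rfl
  | cons v l ih => exact ih _

theorem iterDeriv_zero (l : List E) : iterDeriv l (fun _ => (0 : F)) = fun _ => 0 := by
  induction l with
  | nil => rfl
  | cons v l ih => simpa [iterDeriv] using ih

theorem Filter.EventuallyEq.iterDeriv {f g : E → F} {x : E} (h : f =ᶠ[nhds x] g) (l : List E) :
    iterDeriv l f =ᶠ[nhds x] iterDeriv l g := by
  induction l generalizing f g with
  | nil => exact h
  | cons v l ih =>
    exact ih ((h.fderiv (𝕜 := ℂ)).mono fun y hy => by simp only [hy])

theorem AnalyticOnNhd.dirDeriv [CompleteSpace F] {f : E → F} {U : Set E}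
    (hf : AnalyticOnNhd ℂ f U) (v : E) : AnalyticOnNhd ℂ (fun x => fderiv ℂ f x v) U :=
  (ContinuousLinearMap.apply ℂ F v).comp_analyticOnNhd hf.fderiv

theorem AnalyticOnNhd.iterDeriv [CompleteSpace F] {f : E → F} {U : Set E}
    (hf : AnalyticOnNhd ℂ f U) (l : List E) : AnalyticOnNhd ℂ (iterDeriv l f) U := by
  induction l generalizing f with
  | nil => exact hf
  | cons v l ih => exact ih (hf.dirDeriv v)

theorem iterDeriv_add [CompleteSpace F] {f g : E → F} {U : Set E} (hU : IsOpen U)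
    (hf : AnalyticOnNhd ℂ f U) (hg : AnalyticOnNhd ℂ g U) (l : List E) {x : E} (hx : x ∈ U) :
    iterDeriv l (fun y => f y + g y) x = iterDeriv l f x + iterDeriv l g x := by
  induction l generalizing f g with
  | nil => rfl
  | cons v l ih =>
    refine Eq.trans ?_ (ih (hf.dirDeriv v) (hg.dirDeriv v))
    refine (Filter.EventuallyEq.iterDeriv ?_ l).eq_of_nhds
    filter_upwards [hU.mem_nhds hx] with y hy
    rw [fderiv_fun_add (hf y hy).differentiableAt (hg y hy).differentiableAt]
    rfl

theorem iteratedDeriv_line [CompleteSpace F] {f : E → F} {U : Set E} (hU : IsOpen U)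
    (hf : AnalyticOnNhd ℂ f U) (p v : E) (n : ℕ) {t : ℂ} (ht : p + t • v ∈ U) :
    iteratedDeriv n (fun s : ℂ => f (p + s • v)) t =
      iterDeriv (List.replicate n v) f (p + t • v) := by
  induction n generalizing f with
  | zero => simp [iterDeriv]
  | succ n ih =>
    rw [iteratedDeriv_succ', List.replicate_succ]
    refine Eq.trans ?_ (ih (hf.dirDeriv v))
    refine Filter.EventuallyEq.iteratedDeriv_eq n ?_
    have hc : Continuous fun s : ℂ => p + s • v := by fun_prop
    filter_upwards [(hU.preimage hc).mem_nhds ht] with s hs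
    have hl : HasDerivAt (fun s : ℂ => p + s • v) v s := by
      simpa using ((hasDerivAt_id s).smul_const v).const_add p
    exact ((hf _ hs).differentiableAt.hasFDerivAt.comp_hasDerivAt s hl).deriv

end IterDeriv

/-- Laurent coefficients of a holomorphic function on a disc, as contour integrals. -/
theorem circleIntegral_zpow_mul {h : ℂ → ℂ} {r : ℝ} (hr : 0 < r)
    (hh : DifferentiableOn ℂ h (Metric.closedBall 0 r)) (ν : ℤ) :
    (2 * Real.pi * Complex.I : ℂ)⁻¹ * (∮ z in C(0, r), z ^ (-ν - 1) * h z) =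
      if 0 ≤ ν then ((ν.toNat.factorial : ℂ))⁻¹ * iteratedDeriv ν.toNat h 0 else 0 := by
  split_ifs with hν
  · obtain ⟨n, rfl⟩ := Int.eq_ofNat_of_zero_le hν
    lift r to NNReal using hr.le
    have H := (hh.hasFPowerSeriesOnBall (by exact_mod_cast hr)).factorial_smul 1 n
    rw [← iteratedDeriv_eq_iteratedFDeriv, cauchyPowerSeries_apply] at H
    rw [Int.toNat_natCast, ← H, nsmul_eq_mul,
      inv_mul_cancel_left₀ (by exact_mod_cast n.factorial_ne_zero), smul_eq_mul]
    congr 1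
    refine circleIntegral.integral_congr hr.le fun z hz => ?_
    have hz0 : z ≠ 0 := by
      rintro rfl
      simp at hz
      simp [← hz] at hr
    simp only [sub_zero, smul_eq_mul, one_div, ← mul_assoc]
    congr 1
    rw [zpow_sub₀ hz0, zpow_neg, zpow_one, zpow_natCast, inv_pow]
    rfl
  · rw [Complex.circleIntegral_eq_zero_of_differentiable_on_off_countable hr.le
      Set.countable_empty, mul_zero]
    all_goals obtain ⟨k, hk⟩ := Int.eq_ofNat_of_zero_le (show 0 ≤ -ν - 1 by omega)
    · simp only [hk, zpow_natCast]
      exact (continuous_pow k).continuousOn.mul hh.continuousOn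
    · intro z hz
      simp only [hk, zpow_natCast]
      exact (differentiableAt_pow k).mul
        (hh.differentiableAt (Metric.closedBall_mem_nhds_of_mem hz.1))

section CircleDomain

variable {V0 V1 : Type*} [NormedAddCommGroup V0] [NormedAddCommGroup V1]

/-- The set of `x` for which `(x₀, x₁ / z ^ m, z)` stays in the ball of radius `R` about `(p, 0)`
when `|z| = r`. -/
def circleDomain (m : ℕ) (r R : ℝ) (p : V0) : Set (V0 × V1) :=
  Metric.ball p R ×ˢ Metric.ball 0 (R * r ^ m)

theorem isOpen_circleDomain (m : ℕ) (r R : ℝ) (p : V0) :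
    IsOpen (circleDomain m r R p : Set (V0 × V1)) :=
  Metric.isOpen_ball.prod Metric.isOpen_ball

theorem mem_ball_of_mem_circleDomain [NormedSpace ℂ V1] {m : ℕ} {r R : ℝ} {p : V0}
    (hr : 0 < r) (hrR : r < R) {x : V0 × V1} (hx : x ∈ circleDomain m r R p) {z : ℂ} (hz : z ∈ Metric.sphere (0 : ℂ) r) :
    ((x.1, ((z ^ m)⁻¹ • x.2, z)) : V0 × (V1 × ℂ)) ∈ Metric.ball (p, 0) R := by
  obtain ⟨h1, h2⟩ := hx
  rw [mem_ball_zero_iff] at h2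
  rw [mem_sphere_zero_iff_norm] at hz
  rw [Metric.mem_ball, Prod.dist_eq, max_lt_iff]
  refine ⟨h1, ?_⟩
  rw [dist_zero_right, Prod.norm_mk, max_lt_iff, norm_smul, norm_inv, norm_pow, hz]
  exact ⟨(inv_mul_lt_iff₀' (by positivity)).2 h2, hrR⟩

end CircleDomain

section LaurentCoefficient

variable {V0 V1 : Type*} [NormedAddCommGroup V0] [NormedSpace ℂ V0]
    [NormedAddCommGroup V1] [NormedSpace ℂ V1]

/-- The `ν`-th Laurent coefficient of `z ↦ Q (x₀, x₁ / z ^ m, z)` on the circle `|z| = r`. -/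
def circleCoeff (m : ℕ) (r : ℝ) (ν : ℤ) (Q : V0 × (V1 × ℂ) → ℂ) (x : V0 × V1) : ℂ :=
  (2 * Real.pi * Complex.I : ℂ)⁻¹ *
    ∮ z in C(0, r), z ^ (-ν - 1) * Q (x.1, ((z ^ m)⁻¹ • x.2, z))

/-- The derivative along `vs`, at `(x₀, 0)`, of the `ν`-th Laurent coefficient of
`z ↦ Q (x₀, x₁ / z ^ m, z)`, in terms of the derivatives of `Q`. -/
def coeffDeriv (m : ℕ) : List (V0 × V1) → ℤ → (V0 × (V1 × ℂ) → ℂ) → V0 → ℂ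
  | [], ν, Q, x0 => if 0 ≤ ν then
      ((ν.toNat.factorial : ℂ))⁻¹ * iterDeriv (List.replicate ν.toNat (0, (0, 1))) Q (x0, 0) else 0
  | v :: vs, ν, Q, x0 =>
      coeffDeriv m vs ν (fun y => fderiv ℂ Q y (v.1, 0)) x0 +
        coeffDeriv m vs (ν + m) (fun y => fderiv ℂ Q y (0, (v.2, 0))) x0

theorem coeffDeriv_zero (m : ℕ) (vs : List (V0 × V1)) (ν : ℤ) (x0 : V0) :
    coeffDeriv m vs ν (fun _ => 0) x0 = 0 := by
  induction vs generalizing ν with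
  | nil => simp [coeffDeriv, iterDeriv_zero]
  | cons v vs ih => simp [coeffDeriv, ih]

theorem isPolyFun_coeffDeriv (m : ℕ) (vs : List (V0 × V1)) (ν : ℤ) (Q : V0 × (V1 × ℂ) → ℂ)
    (hQ : ∀ ws, IsPolyFun fun x0 : V0 => iterDeriv ws Q ((x0, 0) : V0 × (V1 × ℂ))) :
    IsPolyFun (coeffDeriv m vs ν Q) := by
  induction vs generalizing ν Q with
  | nil =>
    by_cases hν : 0 ≤ ν
    · simpa only [coeffDeriv, if_pos hν] using! (IsPolyFun.const _).mul (hQ _)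
    · simpa only [coeffDeriv, if_neg hν] using! IsPolyFun.const 0
  | cons v vs ih => exact (ih _ _ fun ws => hQ (_ :: ws)).add (ih _ _ fun ws => hQ (_ :: ws))

theorem coeffDeriv_eq_zero_of_order (m : ℕ) (vs : List (V0 × V1)) (ν K : ℤ)
    (Q : V0 × (V1 × ℂ) → ℂ) (hQ : ∀ ws : List (V0 × (V1 × ℂ)), (ws.length : ℤ) < K →
      iterDeriv ws Q 0 = 0) (hK : (vs.length : ℤ) * (m + 1) + ν < K) :
    coeffDeriv m vs ν Q 0 = 0 := by
  induction vs generalizing ν Q K with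
  | nil =>
    simp only [coeffDeriv]
    split_ifs with hν
    · have h := hQ (List.replicate ν.toNat (0, (0, 1))) (by simp at hK ⊢; omega)
      rw [Prod.mk_zero_zero, h, mul_zero]
    · rfl
  | cons v vs ih =>
    have hm : 0 ≤ (m : ℤ) := by positivity
    simp only [List.length_cons, Nat.cast_add, Nat.cast_one] at hK
    simp only [coeffDeriv]
    rw [ih ν (K - 1), ih (ν + m) (K - 1), add_zero]
    · exact fun ws hw => hQ (_ :: ws) (by simp; omega)
    · linarith
    · exact fun ws hw => hQ (_ :: ws) (by simp; omega)
    · linarith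

theorem coeffDeriv_map_snd (m : ℕ) (ws : List V1) (ν : ℤ) (Q : V0 × (V1 × ℂ) → ℂ) (x0 : V0) :
    coeffDeriv m (ws.map fun w => ((0, w) : V0 × V1)) ν Q x0 =
      coeffDeriv m [] (ν + m * ws.length)
        (iterDeriv (ws.map fun w => ((0, (w, 0)) : V0 × (V1 × ℂ))) Q) x0 := by
  induction ws generalizing ν Q with
  | nil => simp [iterDeriv]
  | cons w ws ih =>
    have h : ν + m * (w :: ws).length = ν + m + m * ws.length := by
      push_cast [List.length_cons]
      ring
    rw [h, List.map_cons, List.map_cons]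
    refine Eq.trans ?_ (ih (ν + m) _)
    have h0 : (fun y => fderiv ℂ Q y ((0, 0) : V0 × (V1 × ℂ))) = fun _ => 0 := by
      ext y
      exact map_zero (fderiv ℂ Q y)
    simp only [coeffDeriv, h0, coeffDeriv_zero, zero_add]

/-- The linear part of `x ↦ (z ↦ (x₀, x₁ / z ^ m, z))`, valued in functions on a circle. -/
def circleLinear (V0 V1 : Type*) [NormedAddCommGroup V0] [NormedSpace ℂ V0]
    [NormedAddCommGroup V1] [NormedSpace ℂ V1] (m : ℕ) {r : ℝ} (hr : 0 < r) :
    (V0 × V1) →L[ℂ] C(Metric.sphere (0 : ℂ) r, V0 × (V1 × ℂ)) :=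
  LinearMap.mkContinuous
    { toFun := fun x => ⟨fun z => (x.1, (((z : ℂ) ^ m)⁻¹ • x.2, 0)), by
        have h : ∀ z : Metric.sphere (0 : ℂ) r, (z : ℂ) ^ m ≠ 0 := fun z =>
          pow_ne_zero _ (ne_zero_of_mem_sphere hr.ne' z)
        have : Continuous fun z : Metric.sphere (0 : ℂ) r => ((z : ℂ) ^ m)⁻¹ :=
          Continuous.inv₀ (by fun_prop) h
        fun_prop⟩
      map_add' := fun x y => by ext z <;> simp
      map_smul' := fun c x => by ext z <;> simp [smul_comm c] }
    (1 + (r ^ m)⁻¹) (by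
      intro x
      refine (ContinuousMap.norm_le _ (by positivity)).2 fun z => ?_
      have hz : ‖(z : ℂ)‖ = r := by simp
      have h1 := norm_fst_le x
      have h2 := norm_snd_le x
      have h3 : 0 ≤ (r ^ m)⁻¹ := by positivity
      have h4 := mul_le_mul_of_nonneg_left h2 h3
      have h5 := norm_nonneg x
      have h6 := mul_nonneg h3 h5
      simp only [LinearMap.coe_mk, AddHom.coe_mk, ContinuousMap.coe_mk, Prod.norm_mk, norm_smul,
        norm_inv, norm_pow, hz, norm_zero]
      refine max_le ?_ (max_le ?_ ?_) <;> nlinarith)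

theorem circleLinear_apply (m : ℕ) {r : ℝ} (hr : 0 < r) (x : V0 × V1)
    (z : Metric.sphere (0 : ℂ) r) :
    circleLinear V0 V1 m hr x z = (x.1, (((z : ℂ) ^ m)⁻¹ • x.2, 0)) := rfl

/-- The map `x ↦ (z ↦ (x₀, x₁ / z ^ m, z))`. -/
def circlePath (m : ℕ) {r : ℝ} (hr : 0 < r) (x : V0 × V1) :
    C(Metric.sphere (0 : ℂ) r, V0 × (V1 × ℂ)) :=
  circleLinear V0 V1 m hr x + ⟨fun z => (0, (0, (z : ℂ))), by fun_prop⟩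

theorem circlePath_apply (m : ℕ) {r : ℝ} (hr : 0 < r) (x : V0 × V1)
    (z : Metric.sphere (0 : ℂ) r) :
    circlePath m hr x z = (x.1, (((z : ℂ) ^ m)⁻¹ • x.2, (z : ℂ))) := by
  simp [circlePath, circleLinear_apply]

theorem hasFDerivAt_circlePath (m : ℕ) {r : ℝ} (hr : 0 < r) (x : V0 × V1) :
    HasFDerivAt (circlePath m hr) (circleLinear V0 V1 m hr) x :=
  (circleLinear V0 V1 m hr).hasFDerivAt.add_const _

theorem analyticAt_circlePath (m : ℕ) {r : ℝ} (hr : 0 < r) (x : V0 × V1) :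
    AnalyticAt ℂ (circlePath m hr) x :=
  ((circleLinear V0 V1 m hr).analyticAt x).add analyticAt_const

/-- The `ν`-th Fourier coefficient of a function on a circle. -/
def fourierFunctional {r : ℝ} (hr : 0 < r) (ν : ℤ) : C(Metric.sphere (0 : ℂ) r, ℂ) →L[ℂ] ℂ :=
  have hw : Continuous fun θ : ℝ => (circleMap 0 r θ) ^ (-ν - 1) :=
    (continuous_circleMap 0 r).zpow₀ _ fun θ => Or.inl (circleMap_ne_center hr.ne')
  have hd : Continuous fun θ : ℝ => deriv (circleMap 0 r) θ := by
    simp only [deriv_circleMap]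
    exact (continuous_circleMap 0 r).mul continuous_const
  have hf : ∀ f : C(Metric.sphere (0 : ℂ) r, ℂ), Continuous fun θ : ℝ =>
      deriv (circleMap 0 r) θ • ((circleMap 0 r θ) ^ (-ν - 1) *
        f ⟨circleMap 0 r θ, circleMap_mem_sphere 0 hr.le θ⟩) := fun f =>
    hd.smul (hw.mul (f.continuous.comp ((continuous_circleMap 0 r).subtype_mk _)))
  LinearMap.mkContinuous
    { toFun := fun f => (2 * Real.pi * Complex.I : ℂ)⁻¹ * ∫ θ in (0)..(2 * Real.pi),
        deriv (circleMap 0 r) θ • ((circleMap 0 r θ) ^ (-ν - 1) *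
          f ⟨circleMap 0 r θ, circleMap_mem_sphere 0 hr.le θ⟩)
      map_add' := fun f g => by
        rw [← mul_add, ← intervalIntegral.integral_add ((hf f).intervalIntegrable _ _)
          ((hf g).intervalIntegrable _ _)]
        simp only [ContinuousMap.add_apply, mul_add, smul_add]
      map_smul' := fun c f => by
        rw [RingHom.id_apply, smul_eq_mul, mul_left_comm, ← intervalIntegral.integral_const_mul c]
        congr 2
        funext θ
        simp only [ContinuousMap.smul_apply, smul_eq_mul]
        ring }
    (‖(2 * Real.pi * Complex.I : ℂ)⁻¹‖ * (r * r ^ (-ν - 1) * |2 * Real.pi - 0|)) (by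
      intro f
      simp only [LinearMap.coe_mk, AddHom.coe_mk, norm_mul (2 * Real.pi * Complex.I : ℂ)⁻¹,
        mul_assoc ‖(2 * Real.pi * Complex.I : ℂ)⁻¹‖]
      gcongr
      refine (intervalIntegral.norm_integral_le_of_norm_le_const
        (C := r * r ^ (-ν - 1) * ‖f‖) fun θ _ => ?_).trans_eq (by ring)
      rw [norm_smul, norm_mul, norm_zpow, deriv_circleMap, norm_mul, Complex.norm_I, mul_one,
        norm_circleMap_zero, abs_of_pos hr, mul_assoc]
      gcongr
      exact f.norm_coe_le_norm _)

theorem fourierFunctional_eq {r : ℝ} (hr : 0 < r) (ν : ℤ) (f : C(Metric.sphere (0 : ℂ) r, ℂ))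
    (g : ℂ → ℂ) (h : ∀ z : Metric.sphere (0 : ℂ) r, f z = g z) :
    fourierFunctional hr ν f =
      (2 * Real.pi * Complex.I : ℂ)⁻¹ * ∮ z in C(0, r), z ^ (-ν - 1) * g z := by
  simp [fourierFunctional, circleIntegral, h]

section Local

variable {m : ℕ} {r R : ℝ} {p : V0} {Q : V0 × (V1 × ℂ) → ℂ}
  {q : FormalMultilinearSeries ℂ (V0 × (V1 × ℂ)) ℂ}

theorem circlePath_mem_ball (hr : 0 < r) (hrR : r < R) {x : V0 × V1}
    (hx : x ∈ circleDomain m r R p) :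
    circlePath m hr x ∈ Metric.ball (ContinuousMap.const _ ((p, 0) : V0 × (V1 × ℂ))) R := by
  rw [Metric.mem_ball, ContinuousMap.dist_lt_iff (hr.trans hrR)]
  intro z
  rw [circlePath_apply]
  exact mem_ball_of_mem_circleDomain hr hrR hx z.2

theorem circleIntegrable_comp_circlePath (hQ : HasFPowerSeriesOnBall Q q (p, 0) (ENNReal.ofReal R))
    (hr : 0 < r) (hrR : r < R) (ν : ℤ) {x : V0 × V1} (hx : x ∈ circleDomain m r R p) :
    CircleIntegrable (fun z : ℂ => z ^ (-ν - 1) * Q (x.1, ((z ^ m)⁻¹ • x.2, z))) 0 r := by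
  have h0 : ∀ z ∈ Metric.sphere (0 : ℂ) r, z ≠ 0 := fun z hz =>
    ne_zero_of_mem_sphere hr.ne' ⟨z, hz⟩
  refine ContinuousOn.circleIntegrable hr.le (ContinuousOn.mul ?_ ?_)
  · exact continuousOn_id.zpow₀ _ fun z hz => Or.inl (h0 z hz)
  · have hc := hQ.continuousOn
    rw [Metric.eball_ofReal] at hc
    refine hc.comp ?_ fun z hz => mem_ball_of_mem_circleDomain hr hrR hx hz
    have : ContinuousOn (fun z : ℂ => (z ^ m)⁻¹) (Metric.sphere (0 : ℂ) r) :=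
      (continuousOn_pow m).inv₀ fun z hz => pow_ne_zero _ (h0 z hz)
    fun_prop

theorem analyticOnNhd_circleCoeff (hQ : HasFPowerSeriesOnBall Q q (p, 0) (ENNReal.ofReal R))
    (hr : 0 < r) (hrR : r < R) (ν : ℤ) :
    AnalyticOnNhd ℂ (circleCoeff m r ν Q) (circleDomain m r R p) := by
  obtain ⟨G, hG, hGQ⟩ := hQ.exists_pointwise (K := Metric.sphere (0 : ℂ) r)
  refine AnalyticOnNhd.congr (isOpen_circleDomain m r R p)
    (f := fun x => fourierFunctional hr ν (G (circlePath m hr x))) ?_ ?_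
  · exact (fourierFunctional hr ν).comp_analyticOnNhd fun x hx =>
      (hG _ (circlePath_mem_ball hr hrR hx)).comp (analyticAt_circlePath m hr x)
  · intro x hx
    refine fourierFunctional_eq hr ν _ (fun z => Q (x.1, ((z ^ m)⁻¹ • x.2, z))) fun z => ?_
    rw [hGQ _ (circlePath_mem_ball hr hrR hx), circlePath_apply]

theorem HasFPowerSeriesOnBall.dirDeriv
    (hQ : HasFPowerSeriesOnBall Q q (p, 0) (ENNReal.ofReal R)) (v : V0 × (V1 × ℂ)) :
    ∃ q' : FormalMultilinearSeries ℂ (V0 × (V1 × ℂ)) ℂ,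
      HasFPowerSeriesOnBall (fun y => fderiv ℂ Q y v) q' (p, 0) (ENNReal.ofReal R) :=
  ⟨_, ContinuousLinearMap.comp_hasFPowerSeriesOnBall
    (ContinuousLinearMap.apply ℂ ℂ v : ((V0 × (V1 × ℂ)) →L[ℂ] ℂ) →L[ℂ] ℂ) hQ.fderiv⟩

theorem fderiv_circleCoeff (hQ : HasFPowerSeriesOnBall Q q (p, 0) (ENNReal.ofReal R))
    (hr : 0 < r) (hrR : r < R) (ν : ℤ) {x : V0 × V1} (hx : x ∈ circleDomain m r R p)
    (v : V0 × V1) :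
    fderiv ℂ (circleCoeff m r ν Q) x v =
      circleCoeff m r ν (fun y => fderiv ℂ Q y (v.1, 0)) x +
        circleCoeff m r (ν + m) (fun y => fderiv ℂ Q y (0, (v.2, 0))) x := by
  obtain ⟨G, hG, hGQ⟩ := hQ.exists_pointwise (K := Metric.sphere (0 : ℂ) r)
  have hU := (isOpen_circleDomain m r R p).mem_nhds hx
  have hGd := ((hG _ (circlePath_mem_ball hr hrR hx)).differentiableAt.hasFDerivAt).comp x
    (hasFDerivAt_circlePath m hr x)
  set D := (fderiv ℂ G (circlePath m hr x)).comp (circleLinear V0 V1 m hr)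
  have hc : circleCoeff m r ν Q =ᶠ[nhds x]
      fun x => fourierFunctional hr ν (G (circlePath m hr x)) := by
    filter_upwards [hU] with y hy
    refine (fourierFunctional_eq hr ν _ (fun z => Q (y.1, ((z ^ m)⁻¹ • y.2, z))) fun z => ?_).symm
    rw [hGQ _ (circlePath_mem_ball hr hrR hy), circlePath_apply]
  have hL : HasFDerivAt (fun x => fourierFunctional hr ν (G (circlePath m hr x)))
      ((fourierFunctional hr ν).comp D) x := (fourierFunctional hr ν).hasFDerivAt.comp x hGd
  rw [hc.fderiv_eq, hL.fderiv, ContinuousLinearMap.comp_apply]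
  have hD : ∀ z : Metric.sphere (0 : ℂ) r, D v z =
      fderiv ℂ Q (x.1, (((z : ℂ) ^ m)⁻¹ • x.2, (z : ℂ))) (v.1, (((z : ℂ) ^ m)⁻¹ • v.2, 0)) := by
    intro z
    have hQa := hQ.analyticOnNhd
    rw [Metric.eball_ofReal] at hQa
    have h1 := (ContinuousMap.evalCLM ℂ z).hasFDerivAt.comp x hGd
    have h2 := (ContinuousMap.evalCLM ℂ z).hasFDerivAt.comp x (hasFDerivAt_circlePath m hr x)
    have h3 := (hQa _ (mem_ball_of_mem_circleDomain hr hrR hx z.2)).differentiableAt.hasFDerivAt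
    rw [← circlePath_apply (hr := hr)] at h3
    have h4 := h3.comp x h2
    have h5 : (fun y => G (circlePath m hr y) z) =ᶠ[nhds x] fun y => Q (circlePath m hr y z) := by
      filter_upwards [hU] with y hy
      exact hGQ _ (circlePath_mem_ball hr hrR hy) z
    have h6 := congrArg (fun T => T v) (h1.unique (h4.congr_of_eventuallyEq h5))
    rw [circlePath_apply] at h6
    exact h6
  rw [fourierFunctional_eq hr ν _
    (fun z => fderiv ℂ Q (x.1, ((z ^ m)⁻¹ • x.2, z)) (v.1, ((z ^ m)⁻¹ • v.2, 0))) hD]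
  obtain ⟨q1, hq1⟩ := hQ.dirDeriv (v.1, 0)
  obtain ⟨q2, hq2⟩ := hQ.dirDeriv (0, (v.2, 0))
  rw [circleCoeff, circleCoeff, ← mul_add, ← circleIntegral.integral_add
    (circleIntegrable_comp_circlePath hq1 hr hrR ν hx)
    (circleIntegrable_comp_circlePath hq2 hr hrR (ν + m) hx)]
  congr 1
  refine circleIntegral.integral_congr hr.le fun z hz => ?_
  have hz0 : z ≠ 0 := ne_zero_of_mem_sphere hr.ne' ⟨z, hz⟩
  have hv : ((v.1, ((z ^ m)⁻¹ • v.2, 0)) : V0 × (V1 × ℂ)) =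
      (v.1, 0) + (z ^ m)⁻¹ • (0, (v.2, 0)) := by simp
  have hp : z ^ (-(ν + m) - 1) = z ^ (-ν - 1) * (z ^ m)⁻¹ := by
    rw [← zpow_natCast, ← zpow_neg, ← zpow_add₀ hz0]
    congr 1
    ring
  simp only [hv, map_add, map_smul, smul_eq_mul, hp]
  ring

theorem circleCoeff_mk_zero (hQ : HasFPowerSeriesOnBall Q q (p, 0) (ENNReal.ofReal R))
    (hr : 0 < r) (hrR : r < R) (ν : ℤ) {x0 : V0} (hx : x0 ∈ Metric.ball p R) :
    circleCoeff m r ν Q (x0, (0 : V1)) = coeffDeriv m [] ν Q x0 := by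
  have hQa := hQ.analyticOnNhd
  rw [Metric.eball_ofReal] at hQa
  have hline : ∀ z : ℂ, (x0, (0, z)) = ((x0, 0) : V0 × (V1 × ℂ)) + z • (0, (0, 1)) := by simp
  have hmem : ∀ z ∈ Metric.ball (0 : ℂ) R, ((x0, (0, z)) : V0 × (V1 × ℂ)) ∈
      Metric.ball (p, 0) R := by
    intro z hz
    have hR := hr.trans hrR
    rw [Metric.mem_ball, Prod.dist_eq, max_lt_iff, dist_zero_right, Prod.norm_mk, max_lt_iff,
      norm_zero]
    exact ⟨hx, hR, by simpa using hz⟩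
  have hd : DifferentiableOn ℂ (fun z : ℂ => Q (x0, (0, z))) (Metric.closedBall 0 r) := by
    intro z hz
    have h := (hQa _ (hmem z (Metric.closedBall_subset_ball hrR hz))).differentiableAt
    exact (h.comp z (f := fun z : ℂ => ((x0, (0, z)) : V0 × (V1 × ℂ)))
      (by fun_prop)).differentiableWithinAt
  have h := circleIntegral_zpow_mul hr hd ν
  simp only [circleCoeff, smul_zero, coeffDeriv]
  rw [h]
  congr 2
  simp only [hline]
  rw [iteratedDeriv_line Metric.isOpen_ball hQa, zero_smul, add_zero]
  rw [← hline]
  exact hmem 0 (by simp [hr.trans hrR])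

theorem iterDeriv_circleCoeff (hQ : HasFPowerSeriesOnBall Q q (p, 0) (ENNReal.ofReal R))
    (hr : 0 < r) (hrR : r < R) (vs : List (V0 × V1)) (ν : ℤ) {x0 : V0}
    (hx : x0 ∈ Metric.ball p R) :
    iterDeriv vs (circleCoeff m r ν Q) (x0, 0) = coeffDeriv m vs ν Q x0 := by
  have hR := hr.trans hrR
  have hx' : ((x0, 0) : V0 × V1) ∈ circleDomain m r R p :=
    ⟨hx, Metric.mem_ball_self (by positivity)⟩
  induction vs generalizing ν Q q with
  | nil => exact circleCoeff_mk_zero hQ hr hrR ν hx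
  | cons v vs ih =>
    obtain ⟨q1, hq1⟩ := hQ.dirDeriv (v.1, 0)
    obtain ⟨q2, hq2⟩ := hQ.dirDeriv (0, (v.2, 0))
    rw [coeffDeriv, ← ih hq1, ← ih hq2, ← iterDeriv_add (isOpen_circleDomain m r R p)
      (analyticOnNhd_circleCoeff hq1 hr hrR ν)
      (analyticOnNhd_circleCoeff hq2 hr hrR (ν + m)) vs hx']
    refine (Filter.EventuallyEq.iterDeriv ?_ vs).eq_of_nhds
    filter_upwards [(isOpen_circleDomain m r R p).mem_nhds hx'] with y hy
    exact fderiv_circleCoeff hQ hr hrR ν hy v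

/-- The `ν`-th Laurent coefficient of `z ↦ Q (x₀, x₁ / z ^ m, z)`, as the sum of its Taylor series
in `x₁`. -/
def laurentCoeff (m : ℕ) (ν : ℤ) (Q : V0 × (V1 × ℂ) → ℂ) (x : V0 × V1) : ℂ :=
  ∑' n : ℕ, (n.factorial : ℂ)⁻¹ • coeffDeriv m (List.replicate n (0, x.2)) ν Q x.1

theorem laurentCoeff_eq_circleCoeff (hQ : HasFPowerSeriesOnBall Q q (p, 0) (ENNReal.ofReal R))
    (hr : 0 < r) (hrR : r < R) (ν : ℤ) {x : V0 × V1} (hx : x ∈ circleDomain m r R p) :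
    laurentCoeff m ν Q x = circleCoeff m r ν Q x := by
  obtain ⟨x0, x1⟩ := x
  have hx1 : ‖x1‖ < R * r ^ m := by simpa using hx.2
  obtain ⟨ρ, hρ, hρR⟩ : ∃ ρ > 1, ρ * ‖x1‖ < R * r ^ m := by
    have hc : Filter.Tendsto (fun ρ : ℝ => ρ * ‖x1‖) (nhdsWithin 1 (Set.Ioi 1))
        (nhds (1 * ‖x1‖)) :=
      ((continuous_id.mul continuous_const).tendsto 1).mono_left nhdsWithin_le_nhds
    rw [one_mul] at hc
    obtain ⟨ρ, h1, h2⟩ := ((hc.eventually_lt_const hx1).and self_mem_nhdsWithin).exists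
    exact ⟨ρ, h2, h1⟩
  have ha := analyticOnNhd_circleCoeff (m := m) hQ hr hrR ν
  have hline : ∀ t : ℂ, (x0, t • x1) = ((x0, 0) : V0 × V1) + t • (0, x1) := by simp
  have hmem : ∀ t ∈ Metric.ball (0 : ℂ) ρ, ((x0, t • x1) : V0 × V1) ∈ circleDomain m r R p := by
    intro t ht
    refine ⟨hx.1, ?_⟩
    rw [mem_ball_zero_iff] at ht ⊢
    rw [norm_smul]
    exact lt_of_le_of_lt (by gcongr) hρR
  have hd : DifferentiableOn ℂ (fun t : ℂ => circleCoeff m r ν Q (x0, t • x1))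
      (Metric.ball 0 ρ) := by
    intro t ht
    exact ((ha _ (hmem t ht)).differentiableAt.comp t (f := fun t : ℂ => ((x0, t • x1) : V0 × V1))
      (by fun_prop)).differentiableWithinAt
  have hs := Complex.hasSum_taylorSeries_on_ball hd (z := 1) (by simpa using hρ)
  rw [one_smul] at hs
  rw [laurentCoeff, ← hs.tsum_eq]
  refine tsum_congr fun n => ?_
  simp only [hline]
  have h0 := hmem 0 (by simp; linarith)
  rw [hline] at h0
  rw [iteratedDeriv_line (isOpen_circleDomain m r R p) ha _ _ _ h0]
  simp [iterDeriv_circleCoeff hQ hr hrR _ ν hx.1]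

end Local

theorem laurentCoeff_local (m : ℕ) (ν : ℤ) {Q : V0 × (V1 × ℂ) → ℂ} {x0 : V0}
    (hQ : AnalyticAt ℂ Q (x0, 0)) :
    AnalyticAt ℂ (laurentCoeff m ν Q) (x0, 0) ∧
      ∀ vs, iterDeriv vs (laurentCoeff m ν Q) (x0, 0) = coeffDeriv m vs ν Q x0 := by
  obtain ⟨q, s, hq⟩ := hQ
  obtain ⟨R, hR, hRs⟩ : ∃ R : ℝ, 0 < R ∧ ENNReal.ofReal R ≤ s := by
    obtain ⟨t, ht, hts⟩ := ENNReal.lt_iff_exists_nnreal_btwn.1 hq.r_pos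
    exact ⟨t, by exact_mod_cast ht, by simpa using hts.le⟩
  have hq' := hq.mono (by simpa using hR) hRs
  have hr : 0 < R / 2 := by positivity
  have hrR : R / 2 < R := by linarith
  have hx : ((x0, 0) : V0 × V1) ∈ circleDomain m (R / 2) R x0 :=
    ⟨Metric.mem_ball_self hR, Metric.mem_ball_self (by positivity)⟩
  have he : laurentCoeff m ν Q =ᶠ[nhds (x0, 0)] circleCoeff m (R / 2) ν Q := by
    filter_upwards [(isOpen_circleDomain m (R / 2) R x0).mem_nhds hx] with y hy
    exact laurentCoeff_eq_circleCoeff hq' hr hrR ν hy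
  refine ⟨(analyticOnNhd_circleCoeff hq' hr hrR ν _ hx).congr he.symm, fun vs => ?_⟩
  rw [(he.iterDeriv vs).eq_of_nhds]
  exact iterDeriv_circleCoeff hq' hr hrR vs ν (Metric.mem_ball_self hR)

end LaurentCoefficient

theorem length_dirs {b : ℕ} {α : Type*} (β : Fin b → ℕ) (g : Fin b → α) :
    ((List.finRange b).flatMap fun j => List.replicate (β j) (g j)).length = ∑ j, β j := by
  simp [List.length_flatMap, Fin.sum_univ_def]

theorem statement17 (a b m : ℕ)
    (P : (Fin a → ℂ) × ((Fin b → ℂ) × ℂ) → ℂ)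
    -- `P ∈ R(V₀ × V₁ × ℂ, V₀)`
    (hP : MemRing (Fin a → ℂ) ((Fin b → ℂ) × ℂ) P)
    -- `P(x₀,0,0) ≡ 0`
    (hP0 : ∀ x0 : Fin a → ℂ, P (x0, 0) = 0) :
    ∀ ν : ℤ, ∃ c : (Fin a → ℂ) × (Fin b → ℂ) → ℂ,
      -- `c_ν` belongs to the ring `R(V₀ × V₁, V₀)`
      MemRing (Fin a → ℂ) (Fin b → ℂ) c ∧
      -- `c_ν` is the `ν`-th Laurent coefficient of `P(x₀, x₁/λ^m, λ)`: its Taylor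
      -- coefficient in `x₁^β` is the Taylor coefficient `p_{β, ν + m|β|}` of `P`
      (∀ (β : Fin b → ℕ) (x0 : Fin a → ℂ),
        if h : 0 ≤ ν + m * (∑ j, β j) then
          ((((ν + m * (∑ j, β j)).toNat).factorial : ℂ)) *
              iterDeriv (dirsC a b β) c (x0, 0) =
            iterDeriv (dirsP a b β ((ν + m * (∑ j, β j)).toNat)) P (x0, 0)
        else iterDeriv (dirsC a b β) c (x0, 0) = 0) ∧
      -- `c₀(x₀, 0) ≡ 0`
      (ν = 0 → ∀ x0 : Fin a → ℂ, c (x0, 0) = 0) ∧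
      -- if `P` vanishes to order `K` at the origin and `ν ≤ K`, then every monomial
      -- `x₀^α x₁^β` of `c_ν` satisfies `|α| + |β| ≥ (K - ν)/(m + 1)`
      ∀ K : ℕ, 0 < K →
        (∀ vs : List ((Fin a → ℂ) × ((Fin b → ℂ) × ℂ)),
          vs.length < K → iterDeriv vs P 0 = 0) →
        ν ≤ (K : ℤ) →
        ∀ vs : List ((Fin a → ℂ) × (Fin b → ℂ)),
          ((vs.length : ℤ)) * (m + 1) + ν < (K : ℤ) → iterDeriv vs c 0 = 0 := by
  intro ν
  obtain ⟨⟨Ω, -, hΩ, hPΩ⟩, hpoly⟩ := hP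
  have hloc := fun x0 => laurentCoeff_local m ν (hPΩ _ (hΩ x0))
  refine ⟨laurentCoeff m ν P, ⟨⟨{x | AnalyticAt ℂ (laurentCoeff m ν P) x}, isOpen_analyticAt ℂ _,
    fun x0 => (hloc x0).1, fun x hx => hx⟩, fun vs => ?_⟩, fun β x0 => ?_, ?_, ?_⟩
  · simpa only [(hloc _).2] using! isPolyFun_coeffDeriv m vs ν P hpoly
  · set L := (List.finRange b).flatMap fun j =>
      List.replicate (β j) (Pi.single j 1 : Fin b → ℂ) with hL
    have hlen : L.length = ∑ j, β j := length_dirs β _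
    have hC : dirsC a b β = L.map fun w => (0, w) := by
      simp [dirsC, hL, List.map_flatMap, x1dirC]
    have hD : ∀ μ, dirsP a b β μ =
        (L.map fun w => (0, (w, 0))) ++ List.replicate μ (0, (0, 1)) := by
      simp [dirsP, hL, List.map_flatMap, x1dirP, lamdirP]
    rw [hC, (hloc x0).2, coeffDeriv_map_snd, hlen]
    split_ifs with h
    · rw [coeffDeriv, if_pos h, hD, iterDeriv_append,
        mul_inv_cancel_left₀ (by exact_mod_cast Nat.factorial_ne_zero _)]
    · rw [coeffDeriv, if_neg h]
  · rintro rfl x0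
    simpa [iterDeriv, coeffDeriv, hP0] using (hloc x0).2 []
  · intro K _ hK _ vs hvs
    exact ((hloc 0).2 vs).trans
      (coeffDeriv_eq_zero_of_order m vs ν K P (fun ws hw => hK ws (by exact_mod_cast hw)) hvs)
end
end

section
/- Let V : (ℂ^{r_1} × ℂ^{r_2}, 0) → (ℂ^N, 0), with r_2 ≥ N, be a germ of a holomorphic map satisfying V(x, ξ)|_{ξ=0} ≡ 0 (where (x,ξ) ∈ ℂ^{r_1} × ℂ^{r_2}), and assume that for any sufficiently small neighborhood 𝒪 of 0 in ℂ^{r_1}, max_{x∈𝒪} rank (∂V/∂ξ)(x, 0) = N. Then there exist germs of holomorphic maps δ : (ℂ^{r_1}, 0) → ℂ with δ(x) ≢ 0, and φ : (ℂ^{r_1} × ℂ^N, 0) → (ℂ^{r_2}, 0), such that V(x, φ(x, Z/δ(x))) ≡ Z for all (x, Z) ∈ ℂ^{r_1} × ℂ^N with δ(x) ≠ 0 and both x and Z/δ(x) sufficiently small. -/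
open scoped BigOperators

noncomputable section

open Filter Topology

section DividedDifference

variable {𝕜 E F : Type*} [NontriviallyNormedField 𝕜] [NormedAddCommGroup E] [NormedSpace 𝕜 E]
  [NormedAddCommGroup F] [NormedSpace 𝕜 F]

/-- The power series of a divided difference `L` with `f y - f z = L (y, z) (y - z)`, where `p` is
the power series of `f`. -/
def FormalMultilinearSeries.dividedDifference (p : FormalMultilinearSeries 𝕜 E F) :
    FormalMultilinearSeries 𝕜 (E × E) (E →L[𝕜] F) := fun n =>
  ∑ i : Fin (n + 1), ((p (n + 1)).curryMid i).flipMultilinear.compContinuousLinearMap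
    fun k => if i.succAbove k < i then .fst 𝕜 E E else .snd 𝕜 E E

theorem FormalMultilinearSeries.dividedDifference_apply (p : FormalMultilinearSeries 𝕜 E F)
    (n : ℕ) (v : Fin n → E × E) (h : E) :
    p.dividedDifference n v h = ∑ i : Fin (n + 1), p (n + 1)
      (i.insertNth h fun k => if i.succAbove k < i then (v k).1 else (v k).2) := by
  simp only [dividedDifference, sum_apply]
  refine Finset.sum_congr rfl fun i _ => ?_
  rw [ContinuousMultilinearMap.compContinuousLinearMap_apply,
    ContinuousLinearMap.flipMultilinear_apply_apply, ContinuousMultilinearMap.curryMid_apply]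
  congr 2
  ext k
  split_ifs <;> rfl

theorem FormalMultilinearSeries.norm_dividedDifference_le (p : FormalMultilinearSeries 𝕜 E F)
    (n : ℕ) : ‖p.dividedDifference n‖ ≤ (n + 1) * ‖p (n + 1)‖ := by
  refine ContinuousMultilinearMap.opNorm_le_bound (by positivity) fun v => ?_
  refine ContinuousLinearMap.opNorm_le_bound _ (by positivity) fun h => ?_
  rw [dividedDifference_apply]
  refine (norm_sum_le_of_le _ (f := _) (n := fun _ => ‖p (n + 1)‖ * ((∏ k, ‖v k‖) * ‖h‖))
    fun i _ => ?_).trans (le_of_eq ?_)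
  · refine (ContinuousMultilinearMap.le_opNorm _ _).trans ?_
    gcongr
    rw [Fin.prod_univ_succAbove _ i, mul_comm]
    simp only [Fin.insertNth_apply_same, Fin.insertNth_apply_succAbove]
    gcongr with k
    split_ifs
    · exact norm_fst_le _
    · exact norm_snd_le _
  · simp
    ring

theorem FormalMultilinearSeries.dividedDifference_apply_sub (p : FormalMultilinearSeries 𝕜 E F)
    (n : ℕ) (y z : E) :
    p.dividedDifference n (fun _ => (y, z)) (y - z) =
      p (n + 1) (fun _ => y) - p (n + 1) (fun _ => z) := by
  set T : ℕ → F := fun j => p (n + 1) fun k => if (k : ℕ) < j then y else z with hT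
  have hy : T (n + 1) = p (n + 1) fun _ => y := by simp only [hT, Fin.is_lt, if_true]
  have hz : T 0 = p (n + 1) fun _ => z := by simp [hT]
  rw [dividedDifference_apply, ← hy, ← hz, ← Finset.sum_range_sub, Finset.sum_range]
  refine Finset.sum_congr rfl fun i _ => ?_
  set m : Fin (n + 1) → E := fun k => if k < i then y else z
  have key (h : E) : (i.insertNth h fun k => if i.succAbove k < i then y else z) =
      Function.update m i h := by
    refine Fin.insertNth_eq_iff.2 ⟨by simp, ?_⟩
    ext k
    simp [Fin.removeNth, m, Fin.succAbove_ne]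
  rw [key, ContinuousMultilinearMap.map_update_sub]
  congr 2 <;> ext k <;> simp only [m, Function.update_apply] <;> grind

theorem FormalMultilinearSeries.radius_dividedDifference_pos (p : FormalMultilinearSeries 𝕜 E F)
    (hp : 0 < p.radius) : 0 < p.dividedDifference.radius := by
  obtain ⟨C, r, hC, hr, h⟩ := p.le_mul_pow_of_radius_pos hp
  lift r to NNReal using hr.le
  have hr' : (0 : NNReal) < (2 * r)⁻¹ := by
    have : 0 < r := by exact_mod_cast hr
    positivity
  refine lt_of_lt_of_le (by exact_mod_cast hr') (le_radius_of_bound _ (C * r) fun n => ?_)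
  have h2 : ((n : ℝ) + 1) ≤ 2 ^ n := by exact_mod_cast Nat.lt_two_pow_self
  calc ‖p.dividedDifference n‖ * (((2 * r)⁻¹ : NNReal) : ℝ) ^ n
      ≤ (2 ^ n * (C * r ^ (n + 1))) * (((2 * r)⁻¹ : NNReal) : ℝ) ^ n := by
        gcongr
        exact (p.norm_dividedDifference_le n).trans (by gcongr; exact h _)
    _ = C * r := by
        push_cast
        rw [inv_pow, mul_pow]
        field_simp
        ring

/-- Hadamard's lemma for analytic functions. -/
theorem AnalyticAt.exists_dividedDifference [CompleteSpace F] {f : E → F} {a : E}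
    (hf : AnalyticAt 𝕜 f a) : ∃ L : E × E → E →L[𝕜] F, AnalyticAt 𝕜 L (a, a) ∧
      ∀ᶠ w in 𝓝 (a, a), f w.1 - f w.2 = L w (w.1 - w.2) := by
  obtain ⟨p, r, hp⟩ := hf
  have hq := p.radius_dividedDifference_pos (hp.r_pos.trans_le hp.r_le)
  set q := p.dividedDifference with hqdef
  refine ⟨fun w => q.sum (w - (a, a)), ?_, ?_⟩
  · have := (q.hasFPowerSeriesOnBall hq).comp_sub (a, a)
    rw [zero_add] at this
    exact this.analyticAt
  have ht : Tendsto (fun w : E × E => w - (a, a)) (𝓝 (a, a)) (𝓝 0) :=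
    Continuous.tendsto' (by fun_prop) _ _ (sub_self _)
  filter_upwards [ht.eventually (Metric.eball_mem_nhds 0 hq),
    continuousAt_fst.eventually (Metric.eball_mem_nhds a hp.r_pos),
    continuousAt_snd.eventually (Metric.eball_mem_nhds a hp.r_pos)] with w hw hy hz
  have H := (q.hasSum hw).mapL (ContinuousLinearMap.apply 𝕜 F (w.1 - w.2))
  have hsub := (hp.hasSum_sub hy).sub (hp.hasSum_sub hz)
  rw [← hasSum_nat_add_iff' 1] at hsub
  simp only [Finset.range_one, Finset.sum_singleton] at hsub
  have h0 : p 0 (fun _ => w.1 - a) - p 0 (fun _ => w.2 - a) = 0 := by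
    rw [sub_eq_zero]; congr 1; ext i; exact i.elim0
  rw [h0, sub_zero] at hsub
  refine hsub.unique ?_
  convert! H using 2 with n
  rw [← p.dividedDifference_apply_sub, sub_sub_sub_cancel_right]
  rfl

end DividedDifference

theorem AnalyticAt.clm_apply {𝕜 E F G : Type*} [NontriviallyNormedField 𝕜] [NormedAddCommGroup E]
    [NormedSpace 𝕜 E] [NormedAddCommGroup F] [NormedSpace 𝕜 F] [NormedAddCommGroup G]
    [NormedSpace 𝕜 G] {f : E → F →L[𝕜] G} {g : E → F} {a : E} (hf : AnalyticAt 𝕜 f a)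
    (hg : AnalyticAt 𝕜 g a) : AnalyticAt 𝕜 (fun x => f x (g x)) a :=
  AnalyticAt.comp (f := fun x => (f x, g x))
    ((ContinuousLinearMap.id 𝕜 (F →L[𝕜] G)).analyticAt_bilinear (f a, g a)) (hf.prod hg)

section Expansion

variable {𝕜 X Y W : Type*} [NontriviallyNormedField 𝕜] [NormedAddCommGroup X] [NormedSpace 𝕜 X]
  [NormedAddCommGroup Y] [NormedSpace 𝕜 Y] [NormedAddCommGroup W] [NormedSpace 𝕜 W]
  [CompleteSpace W]

/-- An analytic `V` is `V (x, ξ) = V (x, 0) + K (x, ξ) ξ` with `K` analytic. -/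
theorem AnalyticAt.exists_clm_slice {V : X × Y → W} (hV : AnalyticAt 𝕜 V 0) :
    ∃ K : X × Y → Y →L[𝕜] W, AnalyticAt 𝕜 K 0 ∧
      ∀ᶠ p in 𝓝 (0 : X × Y), V p = V (p.1, 0) + K p p.2 := by
  obtain ⟨L, hL, h⟩ := hV.exists_dividedDifference
  have hg : AnalyticAt 𝕜 (fun p : X × Y => (p, ((p.1, 0) : X × Y))) 0 :=
    analyticAt_id.prod (analyticAt_fst.prod analyticAt_const)
  refine ⟨fun p => (L (p, (p.1, 0))).comp (.inr 𝕜 X Y), ?_, ?_⟩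
  · exact (ContinuousLinearMap.compL 𝕜 Y (X × Y) W).flip (.inr 𝕜 X Y)
      |>.analyticAt _ |>.comp (hL.comp_of_eq hg rfl)
  · have ht : Tendsto (fun p : X × Y => (p, ((p.1, 0) : X × Y))) (𝓝 0) (𝓝 (0, 0)) :=
      hg.continuousAt
    filter_upwards [ht.eventually h] with p hp
    have hsub : p - (p.1, 0) = (0, p.2) := by ext <;> simp
    rw [← sub_eq_iff_eq_add', hp, hsub]
    rfl

/-- Second-order expansion in `ξ`, with analytic remainder, of a map vanishing on `ξ = 0`. -/
theorem AnalyticAt.exists_expansion {V : X × Y → W} (hV : AnalyticAt 𝕜 V 0)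
    (hslice : ∀ᶠ x in 𝓝 (0 : X), V (x, 0) = 0) :
    ∃ (A : X → Y →L[𝕜] W) (M : X × Y → Y →L[𝕜] Y →L[𝕜] W), AnalyticAt 𝕜 A 0 ∧
      AnalyticAt 𝕜 M 0 ∧ (∀ᶠ x in 𝓝 (0 : X), fderiv 𝕜 (fun ξ => V (x, ξ)) 0 = A x) ∧
      ∀ᶠ p in 𝓝 (0 : X × Y), V p = A p.1 p.2 + M p p.2 p.2 := by
  obtain ⟨K, hK, hVK⟩ := hV.exists_clm_slice
  obtain ⟨M, hM, hKM⟩ := hK.exists_clm_slice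
  have hi : AnalyticAt 𝕜 (fun x : X => ((x, 0) : X × Y)) 0 := by fun_prop
  have hfst : Tendsto (Prod.fst : X × Y → X) (𝓝 0) (𝓝 0) := continuousAt_fst
  have hVK' : ∀ᶠ p in 𝓝 (0 : X × Y), V p = K p p.2 := by
    filter_upwards [hVK, hfst.eventually hslice] with p hp hs
    rw [hp, hs, zero_add]
  refine ⟨fun x => K (x, 0), M, hK.comp_of_eq hi rfl, hM, ?_, ?_⟩
  · have ht : Tendsto (fun x : X => ((x, 0) : X × Y)) (𝓝 0) (𝓝 0) := hi.continuousAt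
    filter_upwards [ht.eventually hVK'.eventually_nhds, ht.eventually hK.eventually_analyticAt]
      with x hx hKx
    have hj : AnalyticAt 𝕜 (fun ξ : Y => (x, ξ)) 0 := by fun_prop
    have hKd : DifferentiableAt 𝕜 (fun ξ : Y => K (x, ξ)) 0 :=
      (hKx.comp_of_eq hj rfl).differentiableAt
    have heq : (fun ξ => V (x, ξ)) =ᶠ[𝓝 0] fun ξ => K (x, ξ) ξ :=
      hj.continuousAt.tendsto.eventually hx
    rw [heq.fderiv_eq]
    refine (hKd.hasFDerivAt.clm_apply (hasFDerivAt_id 0)).fderiv.trans ?_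
    ext v
    simp
  · filter_upwards [hVK', hKM] with p hp hk
    rw [hp, hk]
    simp

end Expansion

theorem AnalyticAt.matrix_det {𝕜 E n : Type*} [NontriviallyNormedField 𝕜] [NormedAddCommGroup E]
    [NormedSpace 𝕜 E] [Fintype n] [DecidableEq n] {M : E → Matrix n n 𝕜} {a : E}
    (h : ∀ i j, AnalyticAt 𝕜 (fun x => M x i j) a) : AnalyticAt 𝕜 (fun x => (M x).det) a := by
  simp only [Matrix.det_apply, Units.smul_def, zsmul_eq_mul]
  exact Finset.analyticAt_fun_sum _ fun σ _ =>
    analyticAt_const.mul (Finset.analyticAt_fun_prod _ fun i _ => h _ _)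

theorem AnalyticAt.matrix_adjugate {𝕜 E n : Type*} [NontriviallyNormedField 𝕜]
    [NormedAddCommGroup E] [NormedSpace 𝕜 E] [Fintype n] [DecidableEq n] {M : E → Matrix n n 𝕜}
    {a : E} (h : ∀ i j, AnalyticAt 𝕜 (fun x => M x i j) a) (i j : n) :
    AnalyticAt 𝕜 (fun x => (M x).adjugate i j) a := by
  simp only [Matrix.adjugate_apply]
  refine AnalyticAt.matrix_det fun k l => ?_
  by_cases hk : k = j
  · subst hk
    simpa using analyticAt_const
  · simpa [hk] using h k l

/-- A holomorphic family of linear maps onto `ℂᴺ` which is surjective at points arbitrarily close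
to the origin has a holomorphic right inverse up to a nonzero scalar function `d`. -/
theorem exists_scaled_rightInverse {ι X Y : Type*} [Fintype ι] [NormedAddCommGroup X]
    [NormedSpace ℂ X] [NormedAddCommGroup Y] [NormedSpace ℂ Y]
    {A : X → Y →L[ℂ] (ι → ℂ)} (hA : AnalyticAt ℂ A 0)
    (hsurj : ∃ᶠ x in 𝓝 (0 : X), Function.Surjective (A x)) :
    ∃ (d : X → ℂ) (b : X × (ι → ℂ) → Y), AnalyticAt ℂ d 0 ∧ AnalyticAt ℂ b 0 ∧
      (¬ ∀ᶠ x in 𝓝 (0 : X), d x = 0) ∧ (∀ x, b (x, 0) = 0) ∧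
      ∀ x w, A x (b (x, w)) = d x • w := by
  classical
  obtain ⟨r, hr, hball⟩ := Metric.eventually_nhds_iff_ball.1 hA.eventually_analyticAt
  obtain ⟨x₀, hx₀, hs⟩ := (hsurj.and_eventually (Metric.ball_mem_nhds 0 hr)).exists.imp
    fun _ h => h.symm
  obtain ⟨B, hB⟩ := (A x₀).toLinearMap.exists_rightInverse_of_surjective
    (LinearMap.range_eq_top.2 hs)
  set B' : (ι → ℂ) →L[ℂ] Y := LinearMap.toContinuousLinearMap B
  set C : X → Matrix ι ι ℂ := fun x => LinearMap.toMatrix' ((A x).toLinearMap ∘ₗ B) with hC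
  have hCan (x : X) (hx : AnalyticAt ℂ A x) (i j : ι) : AnalyticAt ℂ (fun x => C x i j) x := by
    simp only [hC, LinearMap.toMatrix'_apply]
    exact (ContinuousLinearMap.proj (R := ℂ) (φ := fun _ : ι => ℂ) i).analyticAt _ |>.comp
      (AnalyticAt.clm_apply hx analyticAt_const)
  have hAB (x : X) (w : ι → ℂ) : A x (B w) = (C x).mulVec w := by
    rw [← Matrix.toLin'_apply]; simp [hC]
  refine ⟨fun x => (C x).det, fun p => B' ((C p.1).adjugate.mulVec p.2),
    AnalyticAt.matrix_det (hCan 0 hA), ?_, ?_, ?_, ?_⟩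
  · refine (B'.analyticAt _).comp ?_
    refine analyticAt_pi_iff.2 fun i => ?_
    simp only [Matrix.mulVec, dotProduct]
    refine Finset.analyticAt_fun_sum _ fun j _ => ?_
    have h1 : AnalyticAt ℂ (fun p : X × (ι → ℂ) => (C p.1).adjugate i j) 0 :=
      (AnalyticAt.matrix_adjugate (hCan 0 hA) i j).comp_of_eq analyticAt_fst rfl
    have h2 : AnalyticAt ℂ (fun p : X × (ι → ℂ) => p.2 j) 0 :=
      ((ContinuousLinearMap.proj (R := ℂ) (φ := fun _ : ι => ℂ) j).comp
        (.snd ℂ X (ι → ℂ))).analyticAt _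
    exact h1.mul h2
  · intro hd
    have h1 := AnalyticOnNhd.eqOn_zero_of_preconnected_of_eventuallyEq_zero
      (fun x hx => AnalyticAt.matrix_det (hCan x (hball x hx)))
      (convex_ball (0 : X) r).isPreconnected (Metric.mem_ball_self hr) hd hx₀
    have h2 : C x₀ = 1 := by rw [hC]; simp [hB]
    simp [h2] at h1
  · simp
  · intro x w
    change A x (B _) = _
    rw [hAB, Matrix.mulVec_mulVec, Matrix.mul_adjugate, Matrix.smul_mulVec, Matrix.one_mulVec]

/-- If `R` is analytic with zero value and derivative at the origin, then `w + R (x, w) = Z` has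
an analytic solution `w = ψ (x, Z)`. -/
theorem exists_analytic_solution {𝕜 X W : Type*} [RCLike 𝕜] [NormedAddCommGroup X]
    [NormedSpace 𝕜 X] [CompleteSpace X] [NormedAddCommGroup W] [NormedSpace 𝕜 W] [CompleteSpace W]
    {R : X × W → W} (hR : AnalyticAt 𝕜 R 0) (hR0 : R 0 = 0) (hR' : fderiv 𝕜 R 0 = 0) :
    ∃ ψ : X × W → W, AnalyticAt 𝕜 ψ 0 ∧ ψ 0 = 0 ∧
      ∀ᶠ p in 𝓝 (0 : X × W), ψ p + R (p.1, ψ p) = p.2 := by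
  set f : (X × W) × W → W := fun q => q.2 + R (q.1.1, q.2) - q.1.2 with hf
  have hg : AnalyticAt 𝕜 (fun q : (X × W) × W => (q.1.1, q.2)) 0 :=
    (analyticAt_fst.comp analyticAt_fst).prod analyticAt_snd
  have hRg : AnalyticAt 𝕜 (fun q : (X × W) × W => R (q.1.1, q.2)) 0 := hR.comp_of_eq hg rfl
  have hfa : AnalyticAt 𝕜 f 0 :=
    (analyticAt_snd.add hRg).sub (analyticAt_snd.comp analyticAt_fst)
  have hf0 : f 0 = 0 := by simpa [hf, Prod.mk_zero_zero] using hR0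
  have hRd : HasFDerivAt (fun q : (X × W) × W => R (q.1.1, q.2))
      (0 : (X × W) × W →L[𝕜] W) 0 := by
    have h1 : HasFDerivAt R (0 : X × W →L[𝕜] W) 0 := hR' ▸ hR.differentiableAt.hasFDerivAt
    have h2 := hg.differentiableAt.hasFDerivAt
    have := HasFDerivAt.comp (0 : (X × W) × W) (g := R) (g' := 0) h1 h2
    rwa [ContinuousLinearMap.zero_comp] at this
  have hfd := ((hasFDerivAt_snd (𝕜 := 𝕜) (p := (0 : (X × W) × W))).add hRd).sub
    (hasFDerivAt_snd (𝕜 := 𝕜) |>.comp (0 : (X × W) × W) hasFDerivAt_fst)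
  have hinv : (fderiv 𝕜 f 0 ∘L .inr 𝕜 (X × W) W).IsInvertible := by
    refine ⟨.refl 𝕜 W, ?_⟩
    rw [show fderiv 𝕜 f 0 = _ from hfd.fderiv]
    ext w
    simp
  have cdf : ContDiffAt 𝕜 ⊤ f 0 := hfa.contDiffAt
  refine ⟨cdf.implicitFunction (by simp) hinv,
    (cdf.contDiffAt_implicitFunction (by simp) hinv).analyticAt,
    cdf.implicitFunction_apply_self (by simp) hinv, ?_⟩
  filter_upwards [cdf.eventually_apply_implicitFunction (by simp) hinv] with p hp
  rw [hf0] at hp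
  exact sub_eq_zero.1 hp

theorem statement18 (r₁ r₂ N : ℕ) (hr : N ≤ r₂)
    (U : Set ((Fin r₁ → ℂ) × (Fin r₂ → ℂ))) (hU : IsOpen U)
    (h0U : ((0, 0) : (Fin r₁ → ℂ) × (Fin r₂ → ℂ)) ∈ U)
    (V : (Fin r₁ → ℂ) × (Fin r₂ → ℂ) → (Fin N → ℂ))
    (hV : AnalyticOnNhd ℂ V U) (hV00 : V (0, 0) = 0)
    -- `V(x,ξ)|_{ξ=0} ≡ 0` as a germ at the origin
    (hslice : ∀ᶠ x in nhds (0 : Fin r₁ → ℂ), V (x, 0) = 0)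
    -- the generic rank of `ξ ↦ V(x,ξ)` at `ξ = 0`, as `x` varies near `0`, is `N`
    (hrank : ∀ ε : ℝ, 0 < ε → ∃ x : Fin r₁ → ℂ, ‖x‖ < ε ∧
      Module.finrank ℂ
        (LinearMap.range (fderiv ℂ (fun ξ => V (x, ξ)) 0).toLinearMap) = N) :
    ∃ (δ : (Fin r₁ → ℂ) → ℂ) (φ : (Fin r₁ → ℂ) × (Fin N → ℂ) → (Fin r₂ → ℂ)),
      AnalyticAt ℂ δ 0 ∧ ¬ (∀ᶠ x in nhds (0 : Fin r₁ → ℂ), δ x = 0) ∧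
      AnalyticAt ℂ φ 0 ∧ φ (0, 0) = 0 ∧
      ∃ ε : ℝ, 0 < ε ∧ ∀ (x : Fin r₁ → ℂ) (Z : Fin N → ℂ),
        δ x ≠ 0 → ‖x‖ < ε → ‖(δ x)⁻¹ • Z‖ < ε →
          V (x, φ (x, (δ x)⁻¹ • Z)) = Z := by
  obtain ⟨A, M, hA, hM, hVA, hVM⟩ := (hV _ h0U).exists_expansion hslice
  have hsurj : ∃ᶠ x in 𝓝 (0 : Fin r₁ → ℂ), Function.Surjective (A x) := by
    have : ∃ᶠ x in 𝓝 (0 : Fin r₁ → ℂ), Module.finrank ℂ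
        (LinearMap.range (fderiv ℂ (fun ξ => V (x, ξ)) 0).toLinearMap) = N := by
      refine Metric.nhds_basis_ball.frequently_iff.2 fun ε hε => ?_
      obtain ⟨x, hx, h⟩ := hrank ε hε
      exact ⟨x, by simpa using hx, h⟩
    refine (this.and_eventually hVA).mono fun x ⟨h, hx⟩ => ?_
    rw [hx] at h
    exact (LinearMap.range_eq_top (f := (A x).toLinearMap)).1
      (Submodule.eq_top_of_finrank_eq (by simpa using h))
  obtain ⟨d, b, hd, hb, hd0, hb0, hAb⟩ := exists_scaled_rightInverse hA hsurj
  have hd1 : AnalyticAt ℂ (fun p : (Fin r₁ → ℂ) × (Fin N → ℂ) => d p.1) 0 :=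
    hd.comp_of_eq analyticAt_fst rfl
  have hdb : AnalyticAt ℂ (fun p : (Fin r₁ → ℂ) × (Fin N → ℂ) => (p.1, d p.1 • b p)) 0 :=
    analyticAt_fst.prod (hd1.smul hb)
  have hb00 : b 0 = 0 := hb0 0
  have hT : AnalyticAt ℂ (fun p => M (p.1, d p.1 • b p) (b p)) 0 :=
    AnalyticAt.clm_apply (hM.comp_of_eq hdb (by simp [hb00])) hb
  obtain ⟨ψ, hψ, hψ0, hψR⟩ := exists_analytic_solution
    (R := fun p => M (p.1, d p.1 • b p) (b p) (b p)) (AnalyticAt.clm_apply hT hb) (by simp [hb00]) (by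
      rw [(hT.differentiableAt.hasFDerivAt.clm_apply hb.differentiableAt.hasFDerivAt).fderiv]
      simp [hb00])
  have hg : AnalyticAt ℂ (fun p : (Fin r₁ → ℂ) × (Fin N → ℂ) => (p.1, ψ p)) 0 :=
    analyticAt_fst.prod hψ
  have hg0 : ((0 : (Fin r₁ → ℂ) × (Fin N → ℂ)).1, ψ 0) = 0 := by rw [hψ0]; rfl
  have hφ : AnalyticAt ℂ (fun p => d p.1 • b (p.1, ψ p)) 0 := hd1.smul (hb.comp_of_eq hg hg0)
  have hφ0 : d 0 • b (0, ψ 0) = 0 := by rw [hψ0, hb0, smul_zero]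
  refine ⟨fun x => d x ^ 2, fun p => d p.1 • b (p.1, ψ p), hd.pow 2, by simpa using hd0, hφ,
    hφ0, ?_⟩
  have ht : Tendsto (fun p : (Fin r₁ → ℂ) × (Fin N → ℂ) => (p.1, d p.1 • b (p.1, ψ p)))
      (𝓝 0) (𝓝 0) := by
    have := (analyticAt_fst.prod hφ).continuousAt.tendsto
    simpa [hψ0, hb00, Prod.mk_zero_zero] using this
  obtain ⟨ε, hε, h⟩ := Metric.eventually_nhds_iff_ball.1 (hψR.and (ht.eventually hVM))
  refine ⟨ε, hε, fun x Z hδ hx hZ => ?_⟩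
  obtain ⟨h1, h2⟩ := h (x, (d x ^ 2)⁻¹ • Z) (by simpa [Prod.norm_def] using ⟨hx, hZ⟩)
  simp only [map_smul, smul_apply, hAb] at h1 h2
  rw [h2, smul_smul, smul_smul, ← pow_two, ← smul_add, h1, smul_inv_smul₀ hδ]
end
end

section
/- Let V_0, V_1, Ṽ_0, Ṽ_1 be finite-dimensional complex vector spaces with fixed bases and linear coordinates x_0, x_1, x̃_0, x̃_1. Let q ∈ ℂ[x_0] and q̃ ∈ ℂ[x̃_0] be nontrivial polynomials on V_0 and Ṽ_0, and let φ = (φ_0, φ_1) : (ℂ × V_0 × V_1, ℂ × V_0) → (Ṽ_0 × Ṽ_1, Ṽ_0) be a germ of a holomorphic map with components in the ring R(ℂ × V_0 × V_1, ℂ × V_0), satisfying q̃(φ_0(1/q(x_0), x_0, 0)) ≢ 0. Then there exists a ring homomorphism R(ℂ × Ṽ_0 × Ṽ_1, ℂ × Ṽ_0) ∋ f̃ ↦ f ∈ R(ℂ × V_0 × V_1, ℂ × V_0) such that f̃(1/q̃(φ_0(1/q(x_0), x_0, x_1)), φ(1/q(x_0), x_0, x_1)) ≡ f(1/p(x_0),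 x_0, x_1), where p(x_0) := q(x_0)^{d_0+1} · q̃(φ_0(1/q(x_0), x_0, 0)) and d_0 is the degree in θ of the polynomial (θ, x_0) ↦ q̃(φ_0(θ, x_0, 0)). Furthermore, f vanishes on ℂ × V_0 whenever f̃ vanishes on ℂ × Ṽ_0. -/
open scoped BigOperators

noncomputable section

open Filter Topology

section PolyFun

variable {V W : Type*} [AddCommGroup V] [Module ℂ V] [AddCommGroup W] [Module ℂ W]

theorem IsPolyFun.sum {ι : Type*} (s : Finset ι) {f : ι → V → ℂ}
    (hf : ∀ i ∈ s, IsPolyFun (f i)) : IsPolyFun fun x => ∑ i ∈ s, f i x := by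
  classical
  induction s using Finset.induction_on with
  | empty => simpa using IsPolyFun.const (V := V) 0
  | insert i s hi ih =>
    simp only [Finset.sum_insert hi]
    exact (hf i (by simp)).add (ih fun j hj => hf j (by simp [hj]))

theorem IsPolyFun.pow {f : V → ℂ} (hf : IsPolyFun f) (n : ℕ) : IsPolyFun fun x => f x ^ n := by
  induction n with
  | zero => simpa using IsPolyFun.const (V := V) 1
  | succ n ih => simpa only [pow_succ] using ih.mul hf

theorem IsPolyFun.comp {g : W → ℂ} (hg : IsPolyFun g) {ψ : V → W}
    (hψ : ∀ l : W →ₗ[ℂ] ℂ, IsPolyFun fun x => l (ψ x)) : IsPolyFun fun x => g (ψ x) := by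
  induction hg with
  | const c => exact .const c
  | linear l => exact hψ l
  | add _ _ h₁ h₂ => exact h₁.add h₂
  | mul _ _ h₁ h₂ => exact h₁.mul h₂

/-- A polynomial function on `ℂ × V` is a polynomial in the first variable whose coefficients are
polynomial functions on `V`. -/
theorem IsPolyFun.exists_polynomial {f : ℂ × V → ℂ} (hf : IsPolyFun f) :
    ∃ F : Polynomial (V → ℂ), (∀ k, IsPolyFun (F.coeff k)) ∧
      ∀ θ x, f (θ, x) = (F.map (Pi.evalRingHom (fun _ : V => ℂ) x)).eval θ := by
  induction hf with
  | const c =>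
    refine ⟨Polynomial.C fun _ => c, fun k => ?_, fun θ x => by simp⟩
    rw [Polynomial.coeff_C]
    split_ifs
    · exact .const c
    · exact .const 0
  | linear l =>
    refine ⟨Polynomial.C (fun x => l (0, x)) + Polynomial.C (fun _ => l (1, 0)) * Polynomial.X,
      fun k => ?_, fun θ x => ?_⟩
    · rw [Polynomial.coeff_add, Polynomial.coeff_C, Polynomial.coeff_C_mul_X]
      refine IsPolyFun.add (f := if k = 0 then _ else _) (g := if k = 1 then _ else _) ?_ ?_
      · split_ifs
        · exact .linear (l ∘ₗ LinearMap.inr ℂ ℂ V)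
        · exact .const 0
      · split_ifs
        · exact .const _
        · exact .const 0
    · have : ((θ, x) : ℂ × V) = (0, x) + θ • (1, 0) := by simp
      have h : l (θ, x) = l (0, x) + θ * l (1, 0) := by
        rw [this, map_add, map_smul, smul_eq_mul]
      rw [Polynomial.map_add, Polynomial.map_mul, Polynomial.map_C, Polynomial.map_C,
        Polynomial.map_X, Polynomial.eval_add, Polynomial.eval_mul, Polynomial.eval_C,
        Polynomial.eval_C, Polynomial.eval_X, mul_comm]
      exact h
  | add _ _ h₁ h₂ =>
    obtain ⟨F, hF, hF'⟩ := h₁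
    obtain ⟨G, hG, hG'⟩ := h₂
    refine ⟨F + G, fun k => ?_, fun θ x => by simp [hF', hG']⟩
    rw [Polynomial.coeff_add]
    exact (hF k).add (hG k)
  | mul _ _ h₁ h₂ =>
    obtain ⟨F, hF, hF'⟩ := h₁
    obtain ⟨G, hG, hG'⟩ := h₂
    refine ⟨F * G, fun k => ?_, fun θ x => by simp [hF', hG']⟩
    rw [Polynomial.coeff_mul]
    have := IsPolyFun.sum (Finset.HasAntidiagonal.antidiagonal k)
      (f := fun (ij : ℕ × ℕ) x => F.coeff ij.1 x * G.coeff ij.2 x) fun ij _ => (hF ij.1).mul (hG ij.2)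
    convert this using 1
    ext x
    simp

end PolyFun

section FiniteDimensional

variable {V : Type*} [NormedAddCommGroup V] [NormedSpace ℂ V] [FiniteDimensional ℂ V]

theorem IsPolyFun.differentiable {f : V → ℂ} (hf : IsPolyFun f) : Differentiable ℂ f := by
  induction hf with
  | const c => exact differentiable_const c
  | linear l => exact l.toContinuousLinearMap.differentiable
  | add _ _ h₁ h₂ => exact h₁.add h₂
  | mul _ _ h₁ h₂ => exact h₁.mul h₂

/-- Iterated derivatives in the first variable of a function that is, for each value of the second
variable, a polynomial in the first one. -/
theorem iterDeriv_replicate_eq_eval (n : ℕ) (F : Polynomial (V → ℂ))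
    (hF : ∀ k, IsPolyFun (F.coeff k)) (θ : ℂ) (x : V) :
    iterDeriv (List.replicate n ((1 : ℂ), (0 : V)))
        (fun w : ℂ × V => (F.map (Pi.evalRingHom (fun _ : V => ℂ) w.2)).eval w.1) (θ, x) =
      (Polynomial.derivative^[n] (F.map (Pi.evalRingHom (fun _ : V => ℂ) x))).eval θ := by
  induction n generalizing F with
  | zero => rfl
  | succ n ih =>
    have hd : Differentiable ℂ
        fun w : ℂ × V => (F.map (Pi.evalRingHom (fun _ : V => ℂ) w.2)).eval w.1 := by
      have h : (fun w : ℂ × V => (F.map (Pi.evalRingHom (fun _ : V => ℂ) w.2)).eval w.1) =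
          fun w => ∑ k ∈ Finset.range (F.natDegree + 1), F.coeff k w.2 * w.1 ^ k := by
        ext w
        rw [Polynomial.eval_map, Polynomial.eval₂_eq_sum_range]
        rfl
      rw [h]
      refine Differentiable.fun_sum fun k _ => ?_
      have := (hF k).differentiable
      fun_prop
    have key : (fun w : ℂ × V => fderiv ℂ
        (fun w : ℂ × V => (F.map (Pi.evalRingHom (fun _ : V => ℂ) w.2)).eval w.1) w
          ((1 : ℂ), (0 : V))) = fun w : ℂ × V =>
        (F.derivative.map (Pi.evalRingHom (fun _ : V => ℂ) w.2)).eval w.1 := by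
      ext ⟨t, y⟩
      have h₁ : HasDerivAt (fun s : ℂ => ((s, y) : ℂ × V)) ((1 : ℂ), (0 : V)) t :=
        (hasDerivAt_id t).prodMk (hasDerivAt_const t y)
      have h₂ := (hd (t, y)).hasFDerivAt.comp_hasDerivAt t h₁
      have h₃ := (F.map (Pi.evalRingHom (fun _ : V => ℂ) y)).hasDerivAt t
      rw [← Polynomial.derivative_map]
      exact h₂.unique h₃
    rw [List.replicate_succ, iterDeriv, key, ih, Function.iterate_succ_apply,
      Polynomial.derivative_map]
    intro k
    rw [Polynomial.coeff_derivative]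
    exact (hF (k + 1)).mul (.const ((k : ℂ) + 1))

/-- If `f` is polynomial on `ℂ × V` of degree at most `d` in the first variable, then
`q ^ d * f (1 / q, x)` extends to a polynomial function. -/
theorem IsPolyFun.exists_clear_denominator {f : ℂ × V → ℂ} (hf : IsPolyFun f) {q : V → ℂ}
    (hq : IsPolyFun q) (d : ℕ)
    (hd : ∀ w, iterDeriv (List.replicate (d + 1) ((1 : ℂ), (0 : V))) f w = 0) :
    ∃ P : V → ℂ, IsPolyFun P ∧ ∀ x, q x ≠ 0 → P x = q x ^ d * f ((q x)⁻¹, x) := by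
  obtain ⟨F, hF, hfF⟩ := hf.exists_polynomial
  have hf' : f = fun w : ℂ × V => (F.map (Pi.evalRingHom (fun _ : V => ℂ) w.2)).eval w.1 := by
    ext ⟨θ, x⟩
    exact hfF θ x
  have hdeg : ∀ x, (F.map (Pi.evalRingHom (fun _ : V => ℂ) x)).natDegree < d + 1 := by
    intro x
    rw [Nat.lt_succ_iff, Polynomial.natDegree_le_iff_coeff_eq_zero]
    have h0 : Polynomial.derivative^[d + 1] (F.map (Pi.evalRingHom (fun _ : V => ℂ) x)) = 0 := by
      refine Polynomial.funext fun θ => ?_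
      rw [← iterDeriv_replicate_eq_eval _ F hF, ← hf', hd, Polynomial.eval_zero]
    intro N hN
    have h1 := congrArg (fun p => Polynomial.coeff p (N - (d + 1))) h0
    simp only [Polynomial.coeff_iterate_derivative, Polynomial.coeff_zero,
      Nat.sub_add_cancel (show d + 1 ≤ N from hN), nsmul_eq_mul, mul_eq_zero, Nat.cast_eq_zero,
      Nat.descFactorial_eq_zero_iff_lt] at h1
    exact h1.resolve_left (by omega)
  refine ⟨fun x => ∑ k ∈ Finset.range (d + 1), F.coeff k x * q x ^ (d - k),
    IsPolyFun.sum _ fun k _ => (hF k).mul (hq.pow _), fun x hx => ?_⟩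
  rw [hfF, Polynomial.eval_eq_sum_range' (hdeg x), Finset.mul_sum]
  refine Finset.sum_congr rfl fun k hk => ?_
  have hk' : k ≤ d := Nat.lt_succ_iff.1 (Finset.mem_range.1 hk)
  rw [Polynomial.coeff_map, Pi.evalRingHom_apply, inv_pow, pow_sub₀ _ hx hk']
  ring

end FiniteDimensional

section PolyJet

variable {V0 V1 : Type*} [NormedAddCommGroup V0] [NormedSpace ℂ V0]
  [NormedAddCommGroup V1] [NormedSpace ℂ V1]

/-- The function `f` is analytic along `V0 × {0}` and its iterated directional derivatives up to
order `n` restrict to polynomial functions on `V0 × {0}`. -/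
def PolyJet : ℕ → (V0 × V1 → ℂ) → Prop
  | 0, f => (∀ x, AnalyticAt ℂ f (x, 0)) ∧ IsPolyFun fun x => f (x, 0)
  | n + 1, f => ((∀ x, AnalyticAt ℂ f (x, 0)) ∧ IsPolyFun fun x => f (x, 0)) ∧
      ∀ v, PolyJet n fun x => fderiv ℂ f x v

namespace PolyJet

variable {n : ℕ} {f g : V0 × V1 → ℂ}

theorem zero_order (hf : PolyJet n f) : PolyJet 0 f := by
  cases n with
  | zero => exact hf
  | succ n => exact hf.1

theorem analyticAt (hf : PolyJet n f) (x : V0) : AnalyticAt ℂ f (x, 0) := hf.zero_order.1 x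

theorem isPolyFun (hf : PolyJet n f) : IsPolyFun fun x => f (x, 0) := hf.zero_order.2

theorem of_succ (hf : PolyJet (n + 1) f) : PolyJet n f := by
  induction n generalizing f with
  | zero => exact hf.1
  | succ n ih => exact ⟨hf.1, fun v => ih (hf.2 v)⟩

theorem congr (hf : PolyJet n f) (h : ∀ x, f =ᶠ[𝓝 (x, 0)] g) : PolyJet n g := by
  have h0 : PolyJet 0 g := by
    refine ⟨fun x => (hf.analyticAt x).congr (h x), ?_⟩
    have : (fun x => g (x, 0)) = fun x => f (x, 0) := funext fun x => (h x).eq_of_nhds.symm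
    rw [this]
    exact hf.isPolyFun
  induction n generalizing f g with
  | zero => exact h0
  | succ n ih =>
    refine ⟨h0, fun v => ?_⟩
    have h' : ∀ x, (fun y => fderiv ℂ f y v) =ᶠ[𝓝 (x, 0)] fun y => fderiv ℂ g y v := fun x =>
      (h x).fderiv.fun_comp fun l => l v
    refine ih (hf.2 v) h' ⟨fun x => ((hf.2 v).analyticAt x).congr (h' x), ?_⟩
    have : (fun x => fderiv ℂ g (x, 0) v) = fun x => fderiv ℂ f (x, 0) v :=
      funext fun x => (h' x).eq_of_nhds.symm
    rw [this]
    exact (hf.2 v).isPolyFun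

theorem const (c : ℂ) : PolyJet n fun _ : V0 × V1 => c := by
  induction n generalizing c with
  | zero => exact ⟨fun _ => analyticAt_const, .const c⟩
  | succ n ih =>
    refine ⟨⟨fun _ => analyticAt_const, .const c⟩, fun v => ?_⟩
    simpa using ih 0

theorem clm (l : V0 × V1 →L[ℂ] ℂ) : PolyJet n fun x => l x := by
  have h0 : PolyJet 0 fun x => l x :=
    ⟨fun x => l.analyticAt _, .linear (l.toLinearMap ∘ₗ LinearMap.inl ℂ V0 V1)⟩
  cases n with
  | zero => exact h0
  | succ n =>
    refine ⟨h0, fun v => ?_⟩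
    simpa using const (l v)

theorem add (hf : PolyJet n f) (hg : PolyJet n g) : PolyJet n fun x => f x + g x := by
  induction n generalizing f g with
  | zero => exact ⟨fun x => (hf.1 x).add (hg.1 x), hf.2.add hg.2⟩
  | succ n ih =>
    refine ⟨⟨fun x => (hf.1.1 x).add (hg.1.1 x), hf.1.2.add hg.1.2⟩, fun v => ?_⟩
    refine (ih (hf.2 v) (hg.2 v)).congr fun x => ?_
    filter_upwards [(hf.analyticAt x).eventually_analyticAt,
      (hg.analyticAt x).eventually_analyticAt] with y hy hy'
    rw [fderiv_fun_add hy.differentiableAt hy'.differentiableAt]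
    rfl

theorem mul (hf : PolyJet n f) (hg : PolyJet n g) : PolyJet n fun x => f x * g x := by
  induction n generalizing f g with
  | zero => exact ⟨fun x => (hf.1 x).mul (hg.1 x), hf.2.mul hg.2⟩
  | succ n ih =>
    refine ⟨⟨fun x => (hf.1.1 x).mul (hg.1.1 x), hf.1.2.mul hg.1.2⟩, fun v => ?_⟩
    refine ((ih hf.of_succ (hg.2 v)).add (ih hg.of_succ (hf.2 v))).congr fun x => ?_
    filter_upwards [(hf.analyticAt x).eventually_analyticAt,
      (hg.analyticAt x).eventually_analyticAt] with y hy hy'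
    rw [fderiv_fun_mul hy.differentiableAt hy'.differentiableAt]
    rfl

theorem sum {ι : Type*} (s : Finset ι) {f : ι → V0 × V1 → ℂ} (hf : ∀ i ∈ s, PolyJet n (f i)) :
    PolyJet n fun x => ∑ i ∈ s, f i x := by
  classical
  induction s using Finset.induction_on with
  | empty => simpa using const (n := n) (V0 := V0) (V1 := V1) 0
  | insert i s hi ih =>
    simp only [Finset.sum_insert hi]
    exact (hf i (by simp)).add (ih fun j hj => hf j (by simp [hj]))

theorem inv (hf : PolyJet n f) (h1 : ∀ x, f (x, 0) = 1) : PolyJet n fun x => (f x)⁻¹ := by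
  have h0 : PolyJet 0 fun x => (f x)⁻¹ := by
    refine ⟨fun x => (hf.analyticAt x).inv (by simp [h1]), ?_⟩
    simpa [h1] using IsPolyFun.const (V := V0) 1
  induction n with
  | zero => exact h0
  | succ n ih =>
    refine ⟨h0, fun v => ?_⟩
    have hi := ih hf.of_succ
    refine (((const (-1)).mul (hf.2 v)).mul (hi.mul hi)).congr fun x => ?_
    filter_upwards [(hf.analyticAt x).eventually_analyticAt,
      (hf.analyticAt x).continuousAt.eventually_ne (by simp [h1] : f (x, 0) ≠ 0)] with y hy hy'
    have hd : HasFDerivAt (fun z => (f z)⁻¹) _ y :=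
      (hasDerivAt_inv hy').comp_hasFDerivAt y hy.differentiableAt.hasFDerivAt
    rw [hd.fderiv, smul_apply, smul_eq_mul]
    field_simp

theorem polyFun_comp {W : Type*} [AddCommGroup W] [Module ℂ W] {g : W → ℂ} (hg : IsPolyFun g)
    {ψ : V0 × V1 → W} (hψ : ∀ l : W →ₗ[ℂ] ℂ, PolyJet n fun x => l (ψ x)) :
    PolyJet n fun x => g (ψ x) := by
  induction hg with
  | const c => exact .const c
  | linear l => exact hψ l
  | add _ _ h₁ h₂ => exact h₁.add h₂
  | mul _ _ h₁ h₂ => exact h₁.mul h₂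

theorem of_isPolyFun [FiniteDimensional ℂ V0] {g : V0 → ℂ} (hg : IsPolyFun g) :
    PolyJet n fun x : V0 × V1 => g x.1 :=
  polyFun_comp hg fun l => clm (l.toContinuousLinearMap ∘L ContinuousLinearMap.fst ℂ V0 V1)

theorem comp {W0 W1 : Type*} [NormedAddCommGroup W0] [NormedSpace ℂ W0]
    [NormedAddCommGroup W1] [NormedSpace ℂ W1] [FiniteDimensional ℂ W0] [FiniteDimensional ℂ W1]
    {h : W0 × W1 → ℂ} (hh : PolyJet n h) {Φ : V0 × V1 → W0 × W1}
    (hΦ : ∀ l : W0 × W1 →L[ℂ] ℂ, PolyJet n fun x => l (Φ x)) (hΦ0 : ∀ x, (Φ (x, 0)).2 = 0) :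
    PolyJet n fun x => h (Φ x) := by
  let b := Module.finBasis ℂ (W0 × W1)
  let c : ∀ _, W0 × W1 →L[ℂ] ℂ := fun i => (b.coord i).toContinuousLinearMap
  have hb : ∀ y, y = ∑ i, c i y • b i := fun y => (b.sum_repr y).symm
  have hΦa : ∀ x, AnalyticAt ℂ Φ (x, 0) := by
    intro x
    have : Φ = fun x => ∑ i, c i (Φ x) • b i := funext fun x => hb _
    rw [this]
    exact Finset.analyticAt_fun_sum _ fun i _ => ((hΦ (c i)).analyticAt x).smul analyticAt_const
  have hpt : ∀ x, Φ (x, 0) = ((Φ (x, 0)).1, 0) := fun x => Prod.ext rfl (hΦ0 x)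
  have hcomp : ∀ {m : ℕ} {k : W0 × W1 → ℂ}, PolyJet m k → PolyJet 0 fun x => k (Φ x) := by
    intro m k hk
    refine ⟨fun x => ?_, ?_⟩
    · refine AnalyticAt.fun_comp (g := k) ?_ (hΦa x)
      rw [hpt]
      exact hk.analyticAt _
    · have h' : (fun x => k (Φ (x, 0))) = fun x => k ((Φ (x, 0)).1, 0) :=
        funext fun x => by rw [← hpt]
      rw [h']
      exact hk.isPolyFun.comp (ψ := fun x => (Φ (x, 0)).1) fun l =>
        (hΦ (l.toContinuousLinearMap ∘L ContinuousLinearMap.fst ℂ W0 W1)).isPolyFun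
  induction n generalizing h with
  | zero => exact hcomp hh
  | succ n ih =>
    refine ⟨hcomp hh, fun v => ?_⟩
    refine (sum Finset.univ (f := fun i x => fderiv ℂ (fun y => c i (Φ y)) x v *
      fderiv ℂ h (Φ x) (b i)) fun i _ =>
        ((hΦ (c i)).2 v).mul (ih (hh.2 (b i)) fun l => (hΦ l).of_succ)).congr fun x => ?_
    have hha : AnalyticAt ℂ h (Φ (x, 0)) := by
      rw [hpt]
      exact hh.analyticAt _
    filter_upwards [(hΦa x).eventually_analyticAt,
      (hΦa x).continuousAt.eventually hha.eventually_analyticAt] with y hy hy'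
    have hd := hy.differentiableAt
    rw [fderiv_fun_comp y hy'.differentiableAt hd, ContinuousLinearMap.comp_apply]
    conv_rhs => rw [hb (fderiv ℂ Φ y v)]
    rw [map_sum]
    refine Finset.sum_congr rfl fun i _ => ?_
    have hc : HasFDerivAt (fun z => c i (Φ z)) _ y := (c i).hasFDerivAt.comp y hd.hasFDerivAt
    rw [map_smul, smul_eq_mul, hc.fderiv]
    rfl

end PolyJet

theorem memRing_iff_forall_polyJet {f : V0 × V1 → ℂ} :
    MemRing V0 V1 f ↔ ∀ n, PolyJet n f := by
  constructor
  · rintro ⟨⟨Ω, -, hΩ, hf⟩, hp⟩ n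
    have ha : ∀ x : V0, AnalyticAt ℂ f (x, 0) := fun x => hf _ (hΩ x)
    clear hf
    induction n generalizing f with
    | zero => exact ⟨ha, hp []⟩
    | succ n ih =>
      exact ⟨⟨ha, hp []⟩, fun v => ih (fun vs => hp (v :: vs)) fun x =>
        ((ContinuousLinearMap.apply ℂ ℂ v).analyticAt _).fun_comp (ha x).fderiv⟩
  · intro h
    refine ⟨⟨{x | AnalyticAt ℂ f x}, isOpen_analyticAt ℂ f, (h 0).1, fun x hx => hx⟩,
      fun vs => ?_⟩
    induction vs generalizing f with
    | nil => exact (h 0).2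
    | cons v vs ih => exact ih fun n => (h (n + 1)).2 v

end PolyJet

theorem statement19 (a b ta tb : ℕ)
    (q : (Fin a → ℂ) → ℂ) (qt : (Fin ta → ℂ) → ℂ)
    (hq : IsPolyFun q) (hqt : IsPolyFun qt)
    (hqne : ∃ x, q x ≠ 0) (hqtne : ∃ x, qt x ≠ 0)
    (φ : (ℂ × (Fin a → ℂ)) × (Fin b → ℂ) → (Fin ta → ℂ) × (Fin tb → ℂ))
    -- the components of `φ` are in the ring `R(ℂ × V₀ × V₁, ℂ × V₀)`
    (hφ0mem : ∀ i : Fin ta, MemRing (ℂ × (Fin a → ℂ)) (Fin b → ℂ) fun p => (φ p).1 i)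
    (hφ1mem : ∀ i : Fin tb, MemRing (ℂ × (Fin a → ℂ)) (Fin b → ℂ) fun p => (φ p).2 i)
    -- `φ` maps `ℂ × V₀ × {0}` into `Ṽ₀ × {0}`
    (hφ0 : ∀ w : ℂ × (Fin a → ℂ), (φ (w, 0)).2 = 0)
    -- `q̃(φ₀(1/q(x₀), x₀, 0)) ≢ 0`
    (hnv : ∃ x0 : Fin a → ℂ, q x0 ≠ 0 ∧ qt ((φ (((q x0)⁻¹, x0), 0)).1) ≠ 0)
    -- `d₀` is the degree in `θ` of the polynomial `(θ,x₀) ↦ q̃(φ₀(θ,x₀,0))`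
    (d0 : ℕ)
    (hd0a : ∀ w : ℂ × (Fin a → ℂ),
      iterDeriv (List.replicate (d0 + 1) (((1 : ℂ), (0 : Fin a → ℂ))))
        (fun w' : ℂ × (Fin a → ℂ) => qt ((φ (w', 0)).1)) w = 0)
    (hd0b : ¬ ∀ w : ℂ × (Fin a → ℂ),
      iterDeriv (List.replicate d0 (((1 : ℂ), (0 : Fin a → ℂ))))
        (fun w' : ℂ × (Fin a → ℂ) => qt ((φ (w', 0)).1)) w = 0) :
    -- with `p(x₀) := q(x₀)^{d₀+1} ⬝ q̃(φ₀(1/q(x₀), x₀, 0))`,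
    -- there is a ring homomorphism `f̃ ↦ f` as in the statement
    ∃ T : ((ℂ × (Fin ta → ℂ)) × (Fin tb → ℂ) → ℂ) →
        ((ℂ × (Fin a → ℂ)) × (Fin b → ℂ) → ℂ),
      (∀ ft gt : (ℂ × (Fin ta → ℂ)) × (Fin tb → ℂ) → ℂ,
        T (ft + gt) = T ft + T gt ∧ T (ft * gt) = T ft * T gt) ∧
      T 1 = 1 ∧
      (∀ ft, MemRing (ℂ × (Fin ta → ℂ)) (Fin tb → ℂ) ft →
        MemRing (ℂ × (Fin a → ℂ)) (Fin b → ℂ) (T ft)) ∧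
      -- the defining identity of the homomorphism
      (∀ ft, MemRing (ℂ × (Fin ta → ℂ)) (Fin tb → ℂ) ft →
        ∀ x0 : Fin a → ℂ, q x0 ≠ 0 →
          q x0 ^ (d0 + 1) * qt ((φ (((q x0)⁻¹, x0), 0)).1) ≠ 0 →
          ∃ ε : ℝ, 0 < ε ∧ ∀ x1 : Fin b → ℂ, ‖x1‖ < ε →
            ft (((qt ((φ (((q x0)⁻¹, x0), x1)).1))⁻¹, (φ (((q x0)⁻¹, x0), x1)).1),
                (φ (((q x0)⁻¹, x0), x1)).2) =
              T ft (((q x0 ^ (d0 + 1) * qt ((φ (((q x0)⁻¹, x0), 0)).1))⁻¹, x0), x1)) ∧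
      -- `f` vanishes on `ℂ × V₀` whenever `f̃` vanishes on `ℂ × Ṽ₀`
      (∀ ft, MemRing (ℂ × (Fin ta → ℂ)) (Fin tb → ℂ) ft →
        (∀ (θ : ℂ) (xt0 : Fin ta → ℂ), ft ((θ, xt0), 0) = 0) →
        ∀ (θ : ℂ) (x0 : Fin a → ℂ), T ft ((θ, x0), 0) = 0) := by
  have hlin : ∀ {m : ℕ} (l : (Fin m → ℂ) →ₗ[ℂ] ℂ) (y : Fin m → ℂ),
      l y = ∑ i, y i * l (Pi.single i 1) := fun l y => by
    conv_lhs => rw [pi_eq_sum_univ' y]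
    simp [map_sum]
  have hφ0jet : ∀ (n : ℕ) (l : (Fin ta → ℂ) →ₗ[ℂ] ℂ), PolyJet n fun x => l (φ x).1 := by
    intro n l
    rw [funext fun x => hlin l (φ x).1]
    exact PolyJet.sum _ fun i _ => (memRing_iff_forall_polyJet.1 (hφ0mem i) n).mul (.const _)
  have hφ1jet : ∀ (n : ℕ) (l : (Fin tb → ℂ) →ₗ[ℂ] ℂ), PolyJet n fun x => l (φ x).2 := by
    intro n l
    rw [funext fun x => hlin l (φ x).2]
    exact PolyJet.sum _ fun i _ => (memRing_iff_forall_polyJet.1 (hφ1mem i) n).mul (.const _)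
  have hQ : IsPolyFun fun w : ℂ × (Fin a → ℂ) => qt (φ (w, 0)).1 :=
    hqt.comp fun l => (hφ0jet 0 l).isPolyFun
  obtain ⟨P, hP, hPq⟩ := hQ.exists_clear_denominator hq d0 hd0a
  let S : (ℂ × (Fin a → ℂ)) × (Fin b → ℂ) → (ℂ × (Fin a → ℂ)) × (Fin b → ℂ) :=
    fun x => ((P x.1.2 * x.1.1, x.1.2), x.2)
  have hpoly2 : ∀ {g : (Fin a → ℂ) → ℂ}, IsPolyFun g →
      IsPolyFun fun w : ℂ × (Fin a → ℂ) => g w.2 := fun hg =>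
    hg.comp fun l => .linear (l ∘ₗ LinearMap.snd ℂ ℂ _)
  have hpoly1 : IsPolyFun fun w : ℂ × (Fin a → ℂ) => w.1 :=
    IsPolyFun.linear (LinearMap.fst ℂ ℂ (Fin a → ℂ))
  have hS : ∀ (n : ℕ) (l : (ℂ × (Fin a → ℂ)) × (Fin b → ℂ) →L[ℂ] ℂ),
      PolyJet n fun x => l (S x) := by
    intro n l
    have h : (fun x => l (S x)) = fun x => P x.1.2 * x.1.1 * l ((1, 0), 0) +
        (l ∘L (((0 : _ →L[ℂ] ℂ).prod (ContinuousLinearMap.snd ℂ ℂ (Fin a → ℂ))).prodMap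
          (ContinuousLinearMap.id ℂ (Fin b → ℂ)))) x := by
      ext x
      have : S x = (P x.1.2 * x.1.1) • ((1, 0), 0) + ((0, x.1.2), x.2) := by simp [S]
      rw [this, map_add, map_smul, smul_eq_mul]
      rfl
    rw [h]
    exact ((PolyJet.of_isPolyFun ((hpoly2 hP).mul hpoly1)).mul (.const _)).add (.clm _)
  have hS0 : ∀ w, (S (w, 0)).2 = 0 := fun _ => rfl
  let g : (ℂ × (Fin a → ℂ)) × (Fin b → ℂ) → ℂ := fun x => qt (φ (S x)).1
  have hg : ∀ n, PolyJet n g := fun n =>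
    (PolyJet.polyFun_comp hqt (hφ0jet n)).comp (hS n) hS0
  let r : (ℂ × (Fin a → ℂ)) × (Fin b → ℂ) → ℂ := fun x => q x.1.2 ^ (d0 + 1) * x.1.1
  have hr : ∀ n, PolyJet n r := fun n =>
    PolyJet.of_isPolyFun ((hpoly2 (hq.pow (d0 + 1))).mul hpoly1)
  let u : (ℂ × (Fin a → ℂ)) × (Fin b → ℂ) → ℂ :=
    fun x => 1 + r x * (g x + -1 * g (x.1, 0))
  have hu : ∀ n, PolyJet n u := fun n =>
    (PolyJet.const 1).add ((hr n).mul ((hg n).add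
      ((PolyJet.const (-1)).mul (.of_isPolyFun (hg n).isPolyFun))))
  let Θ : (ℂ × (Fin a → ℂ)) × (Fin b → ℂ) → ℂ := fun x => r x * (u x)⁻¹
  have hΘ : ∀ n, PolyJet n Θ := fun n => (hr n).mul ((hu n).inv fun x => by simp [u])
  let Φ : (ℂ × (Fin a → ℂ)) × (Fin b → ℂ) → (ℂ × (Fin ta → ℂ)) × (Fin tb → ℂ) :=
    fun x => ((Θ x, (φ (S x)).1), (φ (S x)).2)
  have hΦ : ∀ (n : ℕ) (l : (ℂ × (Fin ta → ℂ)) × (Fin tb → ℂ) →L[ℂ] ℂ),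
      PolyJet n fun x => l (Φ x) := by
    intro n l
    let l0 : (Fin ta → ℂ) →ₗ[ℂ] ℂ :=
      l.toLinearMap ∘ₗ LinearMap.inl ℂ _ _ ∘ₗ LinearMap.inr ℂ _ _
    let l1 : (Fin tb → ℂ) →ₗ[ℂ] ℂ := l.toLinearMap ∘ₗ LinearMap.inr ℂ _ _
    have h : (fun x => l (Φ x)) =
        fun x => Θ x * l ((1, 0), 0) + (l0 (φ (S x)).1 + l1 (φ (S x)).2) := by
      ext x
      have : Φ x = Θ x • ((1, 0), 0) + (((0, (φ (S x)).1), 0) + (0, (φ (S x)).2)) := by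
        simp [Φ]
      rw [this, map_add, map_add, map_smul, smul_eq_mul]
      rfl
    rw [h]
    exact ((hΘ n).mul (.const _)).add (((hφ0jet n l0).comp (hS n) hS0).add
      ((hφ1jet n l1).comp (hS n) hS0))
  have hΦ0 : ∀ w, (Φ (w, 0)).2 = 0 := fun w => hφ0 _
  refine ⟨fun ft x => ft (Φ x), fun ft gt => ⟨rfl, rfl⟩, rfl, fun ft hft => ?_,
    fun ft _ x0 hx0 hp => ⟨1, one_pos, fun x1 _ => ?_⟩, fun ft _ h0 θ x0 => ?_⟩
  · exact memRing_iff_forall_polyJet.2 fun n =>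
      (memRing_iff_forall_polyJet.1 hft n).comp (hΦ n) hΦ0
  · set p := q x0 ^ (d0 + 1) * qt (φ (((q x0)⁻¹, x0), 0)).1 with hpdef
    have hPp : P x0 * p⁻¹ = (q x0)⁻¹ := by
      rw [hPq x0 hx0, ← div_eq_mul_inv, div_eq_iff hp, eq_inv_mul_iff_mul_eq₀ hx0]
      rw [hpdef, pow_succ]
      ring
    have hSx : ∀ y, S ((p⁻¹, x0), y) = (((q x0)⁻¹, x0), y) := fun y => by
      simp only [S, hPp]
    have hW0 : qt (φ (((q x0)⁻¹, x0), 0)).1 ≠ 0 := right_ne_zero_of_mul hp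
    have hrx : r ((p⁻¹, x0), x1) = (qt (φ (((q x0)⁻¹, x0), 0)).1)⁻¹ := by
      simp only [r, hpdef]
      field_simp
    have hΘx : Θ ((p⁻¹, x0), x1) = (qt (φ (((q x0)⁻¹, x0), x1)).1)⁻¹ := by
      simp only [Θ, u, g, hSx, hrx]
      rw [← mul_inv]
      congr 1
      generalize qt (φ (((q x0)⁻¹, x0), x1)).1 = W
      generalize qt (φ (((q x0)⁻¹, x0), 0)).1 = W0 at hW0 ⊢
      field_simp
      ring
    simp only [Φ, hΘx, hSx]
  · have : Φ ((θ, x0), 0) = ((Φ ((θ, x0), 0)).1, 0) := Prod.ext rfl (hΦ0 _)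
    change ft (Φ ((θ, x0), 0)) = 0
    rw [this]
    exact h0 _ _
end
end
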